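/- Assume Σ is crystallographic. Let T be the unique continuous function on D = {(X,Y) : X ≠ wY for all w ∈ W} with T(X,Y) = (π(X)π(Y))^{−1} ∑_{w∈W} det(w) |X − wY|^{−d} whenever π(X)π(Y) ≠ 0 (such T exists). Let Y₀ ∈ ℝ^d with |Y₀| = 1, and set Σ'₊ = {α ∈ Σ⁺ : ⟨α,Y₀⟩ = 0}, γ' = |Σ'₊|, ρ' = ∑_{α∈Σ'₊} α, π'(X) = ∏_{α∈Σ'₊} ⟨α,X⟩, π''(X) = ∏_{α∈Σ⁺∖Σ'₊} ⟨α,X⟩. Then lim_{X→Y₀, |X|<1} |X − Y₀|^{2γ'+d} · T(X, Y₀) = 2^{2γ'} (d/2)_{γ'} / (π'(ρ') · π''(Y₀)²). Equivalently, the Poisson kernel P^W(X,Y₀) = ((1−|X|²)/(|W| w_d)) T(X,Y₀) of the unit ball satisfies P^W(X,Y₀) ∼ [2^{2γ'} (d/2)_{γ'} / (|W| w_d π'(ρ') π''(Y₀)²)] · (1−|X|²)/|X−Y₀|^{2γ'+d} as X → Y₀ in the open unit ball, where w_d = 2π^{d/2}/Γ(d/2). -/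

import Mathlib

open scoped BigOperators RealInnerProductSpace Classical
open Finset

noncomputable section

/-- Euclidean space `ℝ^d`. -/
abbrev E (d : ℕ) := EuclideanSpace ℝ (Fin d)

/-- The reflection `s_α x = x - 2 (⟪α, x⟫/⟪α, α⟫) α` fixing the hyperplane `α^⊥`. -/
def reflVec {d : ℕ} (α x : E d) : E d := x - (2 * ⟪α, x⟫ / ⟪α, α⟫) • α

/-- `Sig` is a reduced root system in `ℝ^d`: a finite set of nonzero vectors spanning `ℝ^d`,
with `Sig ∩ ℝα = {α, -α}` and `s_α (Sig) = Sig` for all `α ∈ Sig`. -/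
def IsRootSystem {d : ℕ} (Sig : Finset (E d)) : Prop :=
  (0 : E d) ∉ Sig ∧
  Submodule.span ℝ (Sig : Set (E d)) = ⊤ ∧
  (∀ α ∈ Sig, ∀ t : ℝ, t • α ∈ Sig → t = 1 ∨ t = -1) ∧
  (∀ α ∈ Sig, ∀ β ∈ Sig, reflVec α β ∈ Sig)

/-- `Sp` is a positive system for `Sig`: `Sp = {α ∈ Sig : ⟪α, v⟫ > 0}` for a vector `v` not
orthogonal to any root. -/
def IsPositiveSystem {d : ℕ} (Sig Sp : Finset (E d)) : Prop :=
  ∃ v : E d, (∀ α ∈ Sig, ⟪α, v⟫ ≠ 0) ∧ ∀ α : E d, α ∈ Sp ↔ α ∈ Sig ∧ 0 < ⟪α, v⟫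

/-- The Weyl group of `Sig`: the subgroup of the orthogonal group of `ℝ^d` generated by the
reflections `s_α`, `α ∈ Sig`. -/
def weylGroup {d : ℕ} (Sig : Finset (E d)) : Subgroup (E d ≃ₗᵢ[ℝ] E d) :=
  Subgroup.closure {w : E d ≃ₗᵢ[ℝ] E d | ∃ α ∈ Sig, ∀ x : E d, w x = reflVec α x}

/-- Determinant of an orthogonal transformation (`±1`). -/
def dsign {d : ℕ} (w : E d ≃ₗᵢ[ℝ] E d) : ℝ := LinearMap.det (w.toLinearEquiv.toLinearMap)

/-- `π(X) = ∏_{α ∈ Sp} ⟪α, X⟫`. -/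
def piP {d : ℕ} (Sp : Finset (E d)) (X : E d) : ℝ := ∏ α ∈ Sp, ⟪α, X⟫

/-- The set `D = {(X,Y) : X ≠ wY for all w ∈ W}`. -/
def Dset {d : ℕ} (Sig : Finset (E d)) : Set (E d × E d) :=
  {p : E d × E d | ∀ w : weylGroup Sig, p.1 ≠ w.1 p.2}

section

variable {d : ℕ}

/-- The reflection `reflVec α` as a linear isometry. -/
def rootRefl (α : E d) : E d ≃ₗᵢ[ℝ] E d := (ℝ ∙ α)ᗮ.reflection

theorem rootRefl_apply (α x : E d) : rootRefl α x = reflVec α x := by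
  rw [rootRefl, Submodule.reflection_orthogonal_apply, Submodule.reflection_singleton_apply,
    reflVec, real_inner_self_eq_norm_sq, neg_sub, ← Nat.cast_smul_eq_nsmul ℝ, smul_smul]
  simp [mul_div_assoc]

theorem dsign_mul (u w : E d ≃ₗᵢ[ℝ] E d) : dsign (u * w) = dsign u * dsign w := by
  simp only [dsign]
  rw [← LinearMap.det_comp]
  rfl

theorem dsign_one : dsign (1 : E d ≃ₗᵢ[ℝ] E d) = 1 := by
  simp only [dsign]
  exact LinearMap.det_id

theorem dsign_rootRefl {α : E d} (hα : α ≠ 0) : dsign (rootRefl α) = -1 := by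
  have h := Submodule.det_reflection (ℝ ∙ α)ᗮ
  rw [Submodule.orthogonal_orthogonal, finrank_span_singleton hα, pow_one] at h
  exact h

theorem rootRefl_mul_self (α : E d) : rootRefl α * rootRefl α = 1 :=
  Submodule.reflection_mul_reflection _

theorem rootRefl_rootRefl (α x : E d) : rootRefl α (rootRefl α x) = x :=
  Submodule.reflection_reflection _ x

theorem rootRefl_self (α : E d) : rootRefl α α = -α :=
  Submodule.reflection_orthogonalComplement_singleton_eq_neg α

theorem rootRefl_conj (w : E d ≃ₗᵢ[ℝ] E d) (α : E d) :
    rootRefl (w α) * w = w * rootRefl α := by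
  ext1 x
  simp only [LinearIsometryEquiv.coe_mul, Function.comp_apply, rootRefl_apply, reflVec, map_sub,
    map_smul, LinearIsometryEquiv.inner_map_map]

theorem inner_inv_left (w : E d ≃ₗᵢ[ℝ] E d) (x y : E d) : ⟪w⁻¹ x, y⟫ = ⟪x, w y⟫ := by
  rw [← w.inner_map_map (w⁻¹ x) y]
  congr 1
  exact w.apply_symm_apply x

theorem rootRefl_of_inner_eq_zero {α x : E d} (h : ⟪α, x⟫ = 0) : rootRefl α x = x := by
  simp [rootRefl_apply, reflVec, h]

/-- A finite reduced root set, not required to span. -/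
structure IsRootSet (Φ : Finset (E d)) : Prop where
  zero_notMem : (0 : E d) ∉ Φ
  reduced : ∀ α ∈ Φ, ∀ t : ℝ, t • α ∈ Φ → t = 1 ∨ t = -1
  refl_mem : ∀ α ∈ Φ, ∀ β ∈ Φ, reflVec α β ∈ Φ

/-- The roots of `Φ` which are positive on `v`. -/
def posRoots (Φ : Finset (E d)) (v : E d) : Finset (E d) := Φ.filter fun α => 0 < ⟪α, v⟫

theorem mem_posRoots {Φ : Finset (E d)} {v α : E d} :
    α ∈ posRoots Φ v ↔ α ∈ Φ ∧ 0 < ⟪α, v⟫ := by simp [posRoots]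

theorem rootRefl_mem_weylGroup {Φ : Finset (E d)} {α : E d} (hα : α ∈ Φ) :
    rootRefl α ∈ weylGroup Φ :=
  Subgroup.subset_closure ⟨α, hα, fun x => rootRefl_apply α x⟩

namespace IsRootSet

variable {Φ : Finset (E d)}

theorem ne_zero (h : IsRootSet Φ)
    {α : E d} (hα : α ∈ Φ) : α ≠ 0 := fun h0 => h.zero_notMem (h0 ▸ hα)

theorem neg_mem (h : IsRootSet Φ) {α : E d} (hα : α ∈ Φ) : -α ∈ Φ := by
  rw [← rootRefl_self, rootRefl_apply]
  exact h.refl_mem α hα α hα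

theorem weyl_mem (h : IsRootSet Φ)
    {w : E d ≃ₗᵢ[ℝ] E d} (hw : w ∈ weylGroup Φ) : ∀ α ∈ Φ, w α ∈ Φ := by
  induction hw using Subgroup.closure_induction'' with
  | mem x hx =>
    obtain ⟨β, hβ, hx⟩ := hx
    intro α hα
    rw [hx]
    exact h.refl_mem β hβ α hα
  | inv_mem x hx =>
    obtain ⟨β, hβ, hx⟩ := hx
    have : x = rootRefl β := by
      ext1 y
      rw [hx, rootRefl_apply]
    intro α hα
    rw [this, inv_eq_of_mul_eq_one_left (rootRefl_mul_self β), rootRefl_apply]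
    exact h.refl_mem β hβ α hα
  | one => exact fun α hα => hα
  | mul x y _ _ hx hy => exact fun α hα => hx _ (hy α hα)

theorem mem_pos_or_neg (h : IsRootSet Φ)
    {v : E d} (hv : ∀ α ∈ Φ, ⟪α, v⟫ ≠ 0) {α : E d} (hα : α ∈ Φ) :
    α ∈ posRoots Φ v ∨ -α ∈ posRoots Φ v := by
  rcases (hv α hα).lt_or_gt with h1 | h1
  · exact Or.inr (mem_posRoots.2 ⟨h.neg_mem hα, by simpa using h1⟩)
  · exact Or.inl (mem_posRoots.2 ⟨hα, h1⟩)

theorem eq_of_smul (h : IsRootSet Φ)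
    {v α β : E d} (hα : α ∈ posRoots Φ v) (hβ : β ∈ posRoots Φ v) (t : ℝ)
    (ht : β = t • α) : β = α := by
  rw [mem_posRoots] at hα hβ
  rcases h.reduced α hα.1 t (ht ▸ hβ.1) with rfl | rfl
  · simpa using ht
  · have := hβ.2
    rw [ht] at this
    simp at this
    linarith [hα.2]

end IsRootSet

theorem inner_nonneg_of_mem_span {s : Set (E d)} {v : E d} (hs : ∀ α ∈ s, 0 ≤ ⟪α, v⟫) {x : E d}
    (hx : x ∈ Submodule.span NNReal s) : 0 ≤ ⟪x, v⟫ := by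
  induction hx using Submodule.span_induction with
  | mem x hx => exact hs x hx
  | zero => simp
  | add x y _ _ hx hy => rw [inner_add_left]; exact add_nonneg hx hy
  | smul a x _ hx =>
    rw [NNReal.smul_def, real_inner_smul_left]
    exact mul_nonneg a.2 hx

theorem eq_zero_of_mem_span {s : Set (E d)} {v : E d} (hs : ∀ α ∈ s, 0 < ⟪α, v⟫) {x : E d}
    (hx : x ∈ Submodule.span NNReal s) (hx0 : ⟪x, v⟫ ≤ 0) : x = 0 := by
  induction hx using Submodule.span_induction with
  | mem x hx => exact absurd (hs x hx) (not_lt.2 hx0)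
  | zero => rfl
  | add x y hx' hy' hx hy =>
    have h1 := inner_nonneg_of_mem_span (fun α h => (hs α h).le) hx'
    have h2 := inner_nonneg_of_mem_span (fun α h => (hs α h).le) hy'
    rw [inner_add_left] at hx0
    rw [hx (by linarith), hy (by linarith), add_zero]
  | smul a x hx' hx =>
    rcases eq_or_ne a 0 with rfl | ha
    · simp
    · rw [hx, smul_zero]
      rw [NNReal.smul_def, real_inner_smul_left] at hx0
      have : 0 < (a : ℝ) := by positivity
      nlinarith

/-- `Δ` is a system of simple roots for the positive system defined by `v`. -/
structure IsSimpleSystem (Φ : Finset (E d)) (v : E d) (Δ : Finset (E d)) : Prop where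
  subset : Δ ⊆ posRoots Φ v
  span : ∀ β ∈ posRoots Φ v, β ∈ Submodule.span NNReal (Δ : Set (E d))
  refl : ∀ α ∈ Δ, ∀ β ∈ posRoots Φ v, β ≠ α → rootRefl α β ∈ posRoots Φ v

theorem IsRootSet.exists_isSimpleSystem {Φ : Finset (E d)} (h : IsRootSet Φ) {v : E d}
    (hv : ∀ α ∈ Φ, ⟪α, v⟫ ≠ 0) : ∃ Δ, IsSimpleSystem Φ v Δ := by
  obtain ⟨Δ, hΔ, hmin⟩ := Finset.exists_min_image
    ((posRoots Φ v).powerset.filter fun Δ : Finset (E d) => ∀ β ∈ posRoots Φ v,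
      β ∈ Submodule.span NNReal (Δ : Set (E d))) Finset.card
    ⟨posRoots Φ v, by
      simp only [Finset.mem_filter, Finset.mem_powerset, subset_rfl, true_and]
      exact fun β hβ => Submodule.subset_span hβ⟩
  simp only [Finset.mem_filter, Finset.mem_powerset, and_imp] at hΔ hmin
  refine ⟨Δ, hΔ.1, hΔ.2, fun α hα β hβ hne => ?_⟩
  have hαP := hΔ.1 hα
  by_contra hcon
  have hmem : rootRefl α β ∈ Φ := by
    rw [rootRefl_apply]
    exact h.refl_mem _ (mem_posRoots.1 hαP).1 _ (mem_posRoots.1 hβ).1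
  have hγ : -rootRefl α β ∈ posRoots Φ v := (h.mem_pos_or_neg hv hmem).resolve_left hcon
  have hins : (Δ : Set (E d)) = insert α ((Δ.erase α : Finset (E d)) : Set (E d)) := by
    rw [← Finset.coe_insert, Finset.insert_erase hα]
  have hpos : ∀ x ∈ ((Δ.erase α : Finset (E d)) : Set (E d)), 0 < ⟪x, v⟫ := fun x hx =>
    (mem_posRoots.1 (hΔ.1 (Finset.mem_of_mem_erase hx))).2
  have hb := hΔ.2 β hβ
  have hc := hΔ.2 _ hγ
  rw [hins, Submodule.mem_span_insert] at hb hc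
  obtain ⟨b, y, hy, hb⟩ := hb
  obtain ⟨c, z, hz, hc⟩ := hc
  set k : ℝ := 2 * ⟪α, β⟫ / ⟪α, α⟫ with hk
  have hyz : y + z = (k - b - c) • α := by
    have h1 : rootRefl α β = β - k • α := by rw [rootRefl_apply, reflVec]
    rw [h1] at hc
    have h2 : k • α = (b • α + y) + (c • α + z) := by rw [← hb, ← hc]; abel
    rw [sub_smul, sub_smul, h2, NNReal.smul_def, NNReal.smul_def]
    abel
  have hyz' := Submodule.add_mem _ hy hz
  have hαv := (mem_posRoots.1 hαP).2
  rcases le_or_gt (k - b - c) 0 with hle | hlt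
  · have h0 : y + z = 0 := eq_zero_of_mem_span hpos hyz' (by
      rw [hyz, real_inner_smul_left]
      exact mul_nonpos_of_nonpos_of_nonneg hle hαv.le)
    have h1 : ⟪y, v⟫ ≤ 0 := by
      have h2 : ⟪y, v⟫ + ⟪z, v⟫ = 0 := by rw [← inner_add_left, h0, inner_zero_left]
      have := inner_nonneg_of_mem_span (fun α h => (hpos α h).le) hz
      linarith
    have hy0 := eq_zero_of_mem_span hpos hy h1
    apply hne
    refine h.eq_of_smul hαP hβ (b : ℝ) ?_
    rw [hb, hy0, add_zero, NNReal.smul_def]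
  · have hαs : α ∈ Submodule.span NNReal ((Δ.erase α : Finset (E d)) : Set (E d)) := by
      have hsm := Submodule.smul_mem _ (k - b - c).toNNReal⁻¹ hyz'
      rwa [hyz, NNReal.smul_def, smul_smul, NNReal.coe_inv, Real.coe_toNNReal _ hlt.le,
        inv_mul_cancel₀ hlt.ne', one_smul] at hsm
    have hsub : (Δ : Set (E d)) ⊆
        Submodule.span NNReal ((Δ.erase α : Finset (E d)) : Set (E d)) := by
      rw [hins]
      exact Set.insert_subset hαs Submodule.subset_span
    have := hmin (Δ.erase α) ((Finset.erase_subset _ _).trans hΔ.1)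
      (fun β hβ => Submodule.span_le.2 hsub (hΔ.2 β hβ))
    exact absurd (Finset.card_erase_lt_of_mem hα) (not_lt.2 this)

namespace IsSimpleSystem

variable {Φ Δ : Finset (E d)} {v : E d}

theorem mem_root (hΔ : IsSimpleSystem Φ v Δ)
    {α : E d} (hα : α ∈ Δ) : α ∈ Φ := (mem_posRoots.1 (hΔ.subset hα)).1

/-- A vector which pairs nonpositively with all simple roots pairs nonpositively with all
positive roots. -/
theorem inner_nonpos (hΔ : IsSimpleSystem Φ v Δ)
    {x : E d} (hx : ∀ α ∈ Δ, ⟪α, x⟫ ≤ 0) {β : E d} (hβ : β ∈ posRoots Φ v) :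
    ⟪β, x⟫ ≤ 0 := by
  have := inner_nonneg_of_mem_span (v := -x) (s := (Δ : Set (E d)))
    (fun α hα => by rw [inner_neg_right]; linarith [hx α hα]) (hΔ.span β hβ)
  rw [inner_neg_right] at this
  linarith

/-- Every positive root is carried to a simple root by a product of simple reflections. -/
theorem exists_simple_conj (hΔ : IsSimpleSystem Φ v Δ)
    (h : IsRootSet Φ) {β : E d} (hβ : β ∈ posRoots Φ v) :
    ∃ u ∈ weylGroup Δ, u β ∈ Δ := by
  obtain ⟨γ, hγ, hmin⟩ := Finset.exists_min_image
    ((posRoots Φ v).filter fun γ => ∃ u ∈ weylGroup Δ, u β = γ) (fun γ => ⟪γ, v⟫)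
    ⟨β, Finset.mem_filter.2 ⟨hβ, 1, one_mem _, rfl⟩⟩
  obtain ⟨hγP, u, hu, rfl⟩ := Finset.mem_filter.1 hγ
  refine ⟨u, hu, ?_⟩
  by_contra hcon
  have key : ∀ α ∈ Δ, ⟪α, u β⟫ ≤ 0 := by
    intro α hα
    have hαP := hΔ.subset hα
    have hne : u β ≠ α := fun h0 => hcon (h0 ▸ hα)
    have h1 := hΔ.refl α hα _ hγP hne
    have h2 := hmin _ (Finset.mem_filter.2 ⟨h1, rootRefl α * u,
      mul_mem (rootRefl_mem_weylGroup hα) hu, rfl⟩)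
    rw [rootRefl_apply, reflVec, inner_sub_left, real_inner_smul_left] at h2
    have h3 := (mem_posRoots.1 hαP).2
    have h4 : 0 < ⟪α, α⟫ := real_inner_self_pos.2 (h.ne_zero (hΔ.mem_root hα))
    by_contra! h5
    have : 0 < 2 * ⟪α, u β⟫ / ⟪α, α⟫ * ⟪α, v⟫ := by positivity
    linarith
  have h1 := hΔ.inner_nonpos key hγP
  have h2 : 0 < ⟪u β, u β⟫ := real_inner_self_pos.2 (h.ne_zero (mem_posRoots.1 hγP).1)
  linarith

theorem weylGroup_le (hΔ : IsSimpleSystem Φ v Δ) (h : IsRootSet Φ) (hv : ∀ α ∈ Φ, ⟪α, v⟫ ≠ 0) :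
    weylGroup Φ ≤ weylGroup Δ := by
  have key : ∀ β ∈ posRoots Φ v, rootRefl β ∈ weylGroup Δ := by
    intro β hβ
    obtain ⟨u, hu, hub⟩ := hΔ.exists_simple_conj h hβ
    have h1 : rootRefl β = u⁻¹ * rootRefl (u β) * u := by
      rw [mul_assoc, rootRefl_conj, inv_mul_cancel_left]
    rw [h1]
    exact mul_mem (mul_mem (inv_mem hu) (rootRefl_mem_weylGroup hub)) hu
  rw [weylGroup, Subgroup.closure_le]
  rintro x ⟨β, hβ, hx⟩
  have hx' : x = rootRefl β := by
    ext1 y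
    rw [hx, rootRefl_apply]
  rw [hx']
  rcases h.mem_pos_or_neg hv hβ with h1 | h1
  · exact key β h1
  · have h2 : rootRefl (-β) = rootRefl β := by
      ext1 y
      simp [rootRefl_apply, reflVec, neg_div]
    exact h2 ▸ key _ h1

/-- The exchange property for words in simple reflections. -/
theorem exchange (hΔ : IsSimpleSystem Φ v Δ) {α : E d} (hα : α ∈ Δ)
    (L : List (E d)) (hL : ∀ β ∈ L, β ∈ Δ)
    (hneg : (L.map rootRefl).prod α ∉ posRoots Φ v) :
    ∃ L' : List (E d), (∀ β ∈ L', β ∈ Δ) ∧ L'.length + 1 = L.length ∧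
      (L'.map rootRefl).prod = (L.map rootRefl).prod * rootRefl α := by
  induction L with
  | nil => exact absurd (hΔ.subset hα) hneg
  | cons β M ih =>
    have hM : ∀ β ∈ M, β ∈ Δ := fun γ hγ => hL γ (List.mem_cons_of_mem _ hγ)
    have hβ : β ∈ Δ := hL β List.mem_cons_self
    simp only [List.map_cons, List.prod_cons] at hneg ⊢
    by_cases hc : (M.map rootRefl).prod α ∈ posRoots Φ v
    · have heq : (M.map rootRefl).prod α = β := by
        by_contra hne
        exact hneg (hΔ.refl β hβ _ hc hne)
      refine ⟨M, hM, rfl, ?_⟩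
      rw [mul_assoc, ← rootRefl_conj, heq, ← mul_assoc, rootRefl_mul_self, one_mul]
    · obtain ⟨M', hM', hlen, hprod⟩ := ih hM hc
      refine ⟨β :: M', ?_, by simp [hlen], by simp [hprod, mul_assoc]⟩
      intro γ hγ
      rcases List.mem_cons.1 hγ with rfl | hγ
      exacts [hβ, hM' γ hγ]

theorem prod_eq_one (hΔ : IsSimpleSystem Φ v Δ) (n : ℕ) :
    ∀ L : List (E d), L.length = n → (∀ β ∈ L, β ∈ Δ) →
      (∀ β ∈ posRoots Φ v, (L.map rootRefl).prod β ∈ posRoots Φ v) →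
      (L.map rootRefl).prod = 1 := by
  induction n using Nat.strong_induction_on with
  | _ n ih =>
    intro L hn hL hP
    rcases L.eq_nil_or_concat' with rfl | ⟨M, α, rfl⟩
    · rfl
    · have hα : α ∈ Δ := hL α (by simp)
      have hM : ∀ β ∈ M, β ∈ Δ := fun γ hγ => hL γ (by simp [hγ])
      have h1 : ((M ++ [α]).map rootRefl).prod = (M.map rootRefl).prod * rootRefl α := by simp
      rw [h1] at hP ⊢
      have h2 := hP α (hΔ.subset hα)
      have h3 : (M.map rootRefl).prod α ∉ posRoots Φ v := by
        intro h4
        have h5 : ((M.map rootRefl).prod * rootRefl α) α = -(M.map rootRefl).prod α := by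
          rw [LinearIsometryEquiv.coe_mul, Function.comp_apply, rootRefl_self, map_neg]
        rw [h5] at h2
        have h6 := (mem_posRoots.1 h2).2
        have h7 := (mem_posRoots.1 h4).2
        rw [inner_neg_left] at h6
        linarith
      obtain ⟨L', hL', hlen, hprod⟩ := hΔ.exchange hα M hM h3
      rw [← hprod] at hP ⊢
      refine ih L'.length ?_ L' rfl hL' hP
      rw [← hn, List.length_append, List.length_singleton]
      omega

end IsSimpleSystem

namespace IsRootSet

variable {Φ : Finset (E d)}

/-- An element of the Weyl group which preserves a positive system is trivial. -/
theorem eq_one_of_preserves (h : IsRootSet Φ)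
    {v : E d} (hv : ∀ α ∈ Φ, ⟪α, v⟫ ≠ 0) {w : E d ≃ₗᵢ[ℝ] E d}
    (hw : w ∈ weylGroup Φ) (hP : ∀ β ∈ posRoots Φ v, w β ∈ posRoots Φ v) : w = 1 := by
  obtain ⟨Δ, hΔ⟩ := h.exists_isSimpleSystem hv
  have key : ∃ L : List (E d), (∀ β ∈ L, β ∈ Δ) ∧ (L.map rootRefl).prod = w := by
    have hw' := hΔ.weylGroup_le h hv hw
    have aux : ∀ x : E d ≃ₗᵢ[ℝ] E d, (∃ α ∈ Δ, ∀ y, x y = reflVec α y) →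
        ∃ α ∈ Δ, x = rootRefl α := by
      rintro x ⟨α, hα, hx⟩
      refine ⟨α, hα, ?_⟩
      ext1 y
      rw [hx, rootRefl_apply]
    clear hP hw
    induction hw' using Subgroup.closure_induction'' with
    | mem x hx =>
      obtain ⟨α, hα, rfl⟩ := aux x hx
      exact ⟨[α], by simpa using hα, by simp⟩
    | inv_mem x hx =>
      obtain ⟨α, hα, rfl⟩ := aux x hx
      exact ⟨[α], by simpa using hα,
        by simp [inv_eq_of_mul_eq_one_left (rootRefl_mul_self α)]⟩
    | one => exact ⟨[], by simp, rfl⟩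
    | mul x y _ _ hx hy =>
      obtain ⟨L, hL, rfl⟩ := hx
      obtain ⟨M, hM, rfl⟩ := hy
      refine ⟨L ++ M, fun β hβ => ?_, by simp⟩
      rcases List.mem_append.1 hβ with h1 | h1
      exacts [hL β h1, hM β h1]
  obtain ⟨L, hL, rfl⟩ := key
  exact hΔ.prod_eq_one L.length L rfl hL hP

/-- Every vector can be moved into the closed dominant chamber. -/
theorem exists_dominant (h : IsRootSet Φ)
    (hfin : (weylGroup Φ : Set (E d ≃ₗᵢ[ℝ] E d)).Finite) (v x : E d) :
    ∃ w ∈ weylGroup Φ, ∀ α ∈ posRoots Φ v, 0 ≤ ⟪α, w x⟫ := by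
  obtain ⟨w, hw, hmax⟩ := Set.exists_max_image _ (fun w : E d ≃ₗᵢ[ℝ] E d => ⟪w x, v⟫) hfin
    ⟨1, one_mem _⟩
  refine ⟨w, hw, fun α hα => ?_⟩
  have hα' := mem_posRoots.1 hα
  have h1 := hmax (rootRefl α * w) (mul_mem (rootRefl_mem_weylGroup hα'.1) hw)
  simp only [LinearIsometryEquiv.coe_mul, Function.comp_apply, rootRefl_apply, reflVec,
    inner_sub_left, real_inner_smul_left] at h1
  have h4 : 0 < ⟪α, α⟫ := real_inner_self_pos.2 (h.ne_zero hα'.1)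
  by_contra! h5
  have : 0 < 2 * (-⟪α, w x⟫) / ⟪α, α⟫ * ⟪α, v⟫ := by
    have := hα'.2
    have : 0 < -⟪α, w x⟫ := by linarith
    positivity
  rw [mul_neg, neg_div] at this
  linarith

/-- The product of the positive roots is alternating under the Weyl group. -/
theorem piP_weyl (h : IsRootSet Φ) {v : E d} (hv : ∀ α ∈ Φ, ⟪α, v⟫ ≠ 0) {w : E d ≃ₗᵢ[ℝ] E d}
    (hw : w ∈ weylGroup Φ) (x : E d) :
    piP (posRoots Φ v) (w x) = dsign w * piP (posRoots Φ v) x := by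
  obtain ⟨Δ, hΔ⟩ := h.exists_isSimpleSystem hv
  have key : ∀ α ∈ Δ, ∀ x, piP (posRoots Φ v) (rootRefl α x) = -piP (posRoots Φ v) x := by
    intro α hα x
    have hαP := hΔ.subset hα
    have hadj : ∀ a b : E d, ⟪a, rootRefl α b⟫ = ⟪rootRefl α a, b⟫ := by
      intro a b
      rw [← (rootRefl α).inner_map_map a, rootRefl_rootRefl]
    simp only [piP]
    rw [← Finset.mul_prod_erase _ _ hαP, ← Finset.mul_prod_erase _ (fun α => ⟪α, x⟫) hαP, hadj,
      rootRefl_self, inner_neg_left, neg_mul]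
    congr 2
    have hmem : ∀ β ∈ (posRoots Φ v).erase α, rootRefl α β ∈ (posRoots Φ v).erase α := by
      intro β hβ
      rw [Finset.mem_erase] at hβ ⊢
      refine ⟨fun h0 => ?_, hΔ.refl α hα β hβ.2 hβ.1⟩
      have : β = -α := by
        rw [← rootRefl_self, ← rootRefl_rootRefl α β, h0]
      have h1 := (mem_posRoots.1 hβ.2).2
      have h2 := (mem_posRoots.1 hαP).2
      rw [this, inner_neg_left] at h1
      linarith
    refine Finset.prod_nbij' (rootRefl α) (rootRefl α) hmem hmem
      (fun a _ => rootRefl_rootRefl α a) (fun a _ => rootRefl_rootRefl α a) (fun a _ => hadj _ _)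
  have key2 : ∀ u : E d ≃ₗᵢ[ℝ] E d, (∃ α ∈ Δ, ∀ y, u y = reflVec α y) →
      ∀ x, piP (posRoots Φ v) (u x) = dsign u * piP (posRoots Φ v) x := by
    rintro u ⟨α, hα, hu⟩ x
    have : u = rootRefl α := by
      ext1 y
      rw [hu, rootRefl_apply]
    rw [this, key α hα, dsign_rootRefl (h.ne_zero (hΔ.mem_root hα))]
    ring
  have hw' := hΔ.weylGroup_le h hv hw
  clear hw
  induction hw' using Subgroup.closure_induction'' generalizing x with
  | mem u hu => exact key2 u hu x
  | inv_mem u hu =>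
    have : u⁻¹ = u := by
      obtain ⟨α, hα, hu⟩ := hu
      have : u = rootRefl α := by
        ext1 y
        rw [hu, rootRefl_apply]
      rw [this, inv_eq_of_mul_eq_one_left (rootRefl_mul_self α)]
    rw [this]
    exact key2 u hu x
  | one => simp [dsign_one]
  | mul u w _ _ hu hw =>
    rw [LinearIsometryEquiv.coe_mul, Function.comp_apply, hu, hw, dsign_mul, mul_assoc]

end IsRootSet

theorem IsRootSet.filter_orthogonal {Φ : Finset (E d)} (h : IsRootSet Φ) (Y : E d) :
    IsRootSet (Φ.filter fun α => ⟪α, Y⟫ = 0) where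
  zero_notMem h0 := h.zero_notMem (Finset.mem_filter.1 h0).1
  reduced α hα t ht := h.reduced α (Finset.mem_filter.1 hα).1 t (Finset.mem_filter.1 ht).1
  refl_mem α hα β hβ := by
    rw [Finset.mem_filter] at hα hβ ⊢
    refine ⟨h.refl_mem α hα.1 β hβ.1, ?_⟩
    rw [reflVec, inner_sub_left, real_inner_smul_left, hα.2, hβ.2]
    simp

theorem weylGroup_mono {Φ Ψ : Finset (E d)} (h : Φ ⊆ Ψ) : weylGroup Φ ≤ weylGroup Ψ :=
  Subgroup.closure_mono fun _ ⟨α, hα, hx⟩ => ⟨α, h hα, hx⟩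

theorem weylGroup_filter_fixes {Φ : Finset (E d)} {Y : E d} {w : E d ≃ₗᵢ[ℝ] E d}
    (hw : w ∈ weylGroup (Φ.filter fun α => ⟪α, Y⟫ = 0)) : w Y = Y := by
  induction hw using Subgroup.closure_induction with
  | mem x hx =>
    obtain ⟨α, hα, hx⟩ := hx
    rw [hx, reflVec, (Finset.mem_filter.1 hα).2]
    simp
  | one => rfl
  | mul x y _ _ hx hy => rw [LinearIsometryEquiv.coe_mul, Function.comp_apply, hy, hx]
  | inv x _ hx => exact (LinearIsometryEquiv.symm_apply_eq x).2 hx.symm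

/-- The stabilizer of a point in a finite reflection group is generated by the reflections
fixing the point. -/
theorem IsRootSet.mem_weylGroup_filter {Φ : Finset (E d)} (h : IsRootSet Φ)
    (hfin : (weylGroup Φ : Set (E d ≃ₗᵢ[ℝ] E d)).Finite) {v : E d}
    (hv : ∀ α ∈ Φ, ⟪α, v⟫ ≠ 0) {Y : E d} {w : E d ≃ₗᵢ[ℝ] E d} (hw : w ∈ weylGroup Φ)
    (hwY : w Y = Y) : w ∈ weylGroup (Φ.filter fun α => ⟪α, Y⟫ = 0) := by
  set Ψ := Φ.filter fun α => ⟪α, Y⟫ = 0 with hΨ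
  have hle : weylGroup Ψ ≤ weylGroup Φ := weylGroup_mono (Finset.filter_subset _ _)
  obtain ⟨ε, hε, hεΦ⟩ : ∃ ε : ℝ, 0 < ε ∧ ∀ α ∈ Φ, ⟪α, Y⟫ ≠ 0 → ε * |⟪α, v⟫| < |⟪α, Y⟫| := by
    have h1 : ∀ α ∈ Φ, ∀ᶠ ε : ℝ in nhdsWithin 0 (Set.Ioi 0),
        ⟪α, Y⟫ ≠ 0 → ε * |⟪α, v⟫| < |⟪α, Y⟫| := by
      intro α _
      by_cases h0 : ⟪α, Y⟫ = 0
      · simp [h0]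
      · have : Filter.Tendsto (fun ε : ℝ => ε * |⟪α, v⟫|) (nhdsWithin 0 (Set.Ioi 0))
            (nhds (0 * |⟪α, v⟫|)) :=
          ((continuous_id.mul continuous_const).tendsto 0).mono_left nhdsWithin_le_nhds
        rw [zero_mul] at this
        filter_upwards [this.eventually (gt_mem_nhds (abs_pos.2 h0))] with ε hε _ using hε
    have h2 := ((Filter.eventually_all_finset Φ).2 h1).and self_mem_nhdsWithin
    obtain ⟨ε, h3, h4⟩ := h2.exists
    exact ⟨ε, h4, h3⟩
  obtain ⟨g, hg, hdom⟩ := (h.filter_orthogonal Y).exists_dominant (hfin.subset hle) v (w v)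
  have hgY := weylGroup_filter_fixes hg
  set u := g * w with hu
  have huΦ : u ∈ weylGroup Φ := mul_mem (hle hg) hw
  have huY : u Y = Y := by rw [hu, LinearIsometryEquiv.coe_mul, Function.comp_apply, hwY, hgY]
  have hval : ∀ α : E d, ⟪α, Y + ε • v⟫ = ⟪α, Y⟫ + ε * ⟪α, v⟫ := by
    intro α
    rw [inner_add_right, real_inner_smul_right]
  have hbd : ∀ α ∈ Φ, ⟪α, Y⟫ ≠ 0 → (0 < ⟪α, Y + ε • v⟫ ↔ 0 < ⟪α, Y⟫) := by
    intro α hα h0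
    have h1 := hεΦ α hα h0
    rw [hval]
    have h2 : |ε * ⟪α, v⟫| < |⟪α, Y⟫| := by rwa [abs_mul, abs_of_pos hε]
    rcases lt_or_gt_of_ne h0 with h3 | h3
    · rw [abs_of_neg h3, abs_lt] at h2
      constructor <;> intro <;> linarith
    · rw [abs_of_pos h3, abs_lt] at h2
      constructor <;> intro <;> linarith
  have hreg : ∀ α ∈ Φ, ⟪α, Y + ε • v⟫ ≠ 0 := by
    intro α hα h0
    by_cases h1 : ⟪α, Y⟫ = 0
    · rw [hval, h1, zero_add] at h0
      exact (mul_ne_zero hε.ne' (hv α hα)) h0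
    · have h2 := hbd α hα h1
      have h3 := hbd (-α) (h.neg_mem hα) (by simpa using h1)
      simp only [inner_neg_left, h0] at h2 h3
      rcases lt_or_gt_of_ne h1 with h4 | h4
      · exact absurd (h3.2 (by linarith)) (by simp)
      · exact absurd (h2.2 h4) (by simp)
  have hu1 : u⁻¹ = 1 := by
    refine h.eq_one_of_preserves hreg (inv_mem huΦ) fun α hα => ?_
    rw [mem_posRoots] at hα ⊢
    have hmem := h.weyl_mem (inv_mem huΦ) α hα.1
    have hY : ⟪u⁻¹ α, Y⟫ = ⟪α, Y⟫ := by rw [inner_inv_left, huY]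
    refine ⟨hmem, ?_⟩
    by_cases h0 : ⟪α, Y⟫ = 0
    · have h1 := hα.2
      rw [hval, h0, zero_add] at h1
      have h2 : 0 < ⟪α, v⟫ := pos_of_mul_pos_right h1 hε.le
      have h3 := hdom α (mem_posRoots.2 ⟨Finset.mem_filter.2 ⟨hα.1, h0⟩, h2⟩)
      have h4 : ⟪u⁻¹ α, v⟫ = ⟪α, g (w v)⟫ := inner_inv_left _ _ _
      rw [hval, hY, h0, zero_add]
      exact mul_pos hε (lt_of_le_of_ne (h4 ▸ h3) (hv _ hmem).symm)
    · rw [hbd _ hmem (hY ▸ h0), hY]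
      exact (hbd α hα.1 h0).1 hα.2
  have : w = g⁻¹ := by
    rw [inv_eq_one] at hu1
    exact (inv_eq_of_mul_eq_one_right (hu ▸ hu1)).symm
  rw [this]
  exact inv_mem hg

open Polynomial in
/-- Iterated central differences of a polynomial of degree at most the number of steps. -/
theorem sum_powerset_central_difference {ι : Type*} (P : Finset ι) (a : ι → ℝ) :
    ∀ (q : ℝ[X]), q.natDegree ≤ #P → ∀ x : ℝ,
      ∑ S ∈ P.powerset, (-1) ^ #S * q.eval (x + ∑ i ∈ P, a i - 2 * ∑ i ∈ S, a i) =
        2 ^ #P * (#P).factorial * q.coeff #P * ∏ i ∈ P, a i := by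
  induction P using Finset.induction_on with
  | empty =>
    intro q hq x
    rw [Finset.card_empty, Nat.le_zero] at hq
    rw [Polynomial.eq_C_of_natDegree_eq_zero hq]
    simp
  | insert i P hi ih =>
    intro q hq x
    rw [Finset.card_insert_of_notMem hi] at hq ⊢
    set n := #P with hn
    set r := taylor (a i) q - taylor (-a i) q with hr
    have hlin : ∀ k, n ≤ k → ∀ y, (taylor y q).coeff k =
        q.coeff k + (k + 1) * q.coeff (k + 1) * y := by
      intro k hk y
      rw [taylor_coeff]
      have h1 : (hasseDeriv k q).natDegree ≤ 1 := (natDegree_hasseDeriv_le q k).trans (by omega)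
      rw [Polynomial.eq_X_add_C_of_natDegree_le_one h1]
      simp [hasseDeriv_coeff, add_comm 1 k]
      ring
    have hrdeg : r.natDegree ≤ n := by
      rw [Polynomial.natDegree_le_iff_coeff_eq_zero]
      intro k hk
      rw [hr, coeff_sub, hlin k hk.le, hlin k hk.le,
        q.coeff_eq_zero_of_natDegree_lt (n := k + 1) (by omega)]
      ring
    have hrco : r.coeff n = 2 * a i * (n + 1) * q.coeff (n + 1) := by
      rw [hr, coeff_sub, hlin n le_rfl, hlin n le_rfl]
      ring
    have key := ih r hrdeg x
    rw [hrco] at key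
    rw [Finset.sum_powerset_insert hi, ← Finset.sum_add_distrib, Finset.sum_insert hi,
      Finset.prod_insert hi, Nat.factorial_succ]
    rw [show (2 : ℝ) ^ (n + 1) * ((n + 1) * n.factorial : ℕ) * q.coeff (n + 1) *
      (a i * ∏ j ∈ P, a j) = 2 ^ n * n.factorial * (2 * a i * (n + 1) * q.coeff (n + 1)) *
      ∏ j ∈ P, a j by push_cast; ring, ← key]
    refine Finset.sum_congr rfl fun S hS => ?_
    have hiS : i ∉ S := fun h => hi (Finset.mem_powerset.1 hS h)
    rw [Finset.card_insert_of_notMem hiS, Finset.sum_insert hiS, hr, eval_sub, taylor_eval,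
      taylor_eval, show x + (a i + ∑ j ∈ P, a j) - 2 * ∑ j ∈ S, a j =
        x + ∑ j ∈ P, a j - 2 * ∑ j ∈ S, a j + a i by ring,
      show x + (a i + ∑ j ∈ P, a j) - 2 * (a i + ∑ j ∈ S, a j) =
        x + ∑ j ∈ P, a j - 2 * ∑ j ∈ S, a j + -a i by ring]
    ring

theorem sum_powerset_sub_pow_card {ι : Type*} (P : Finset ι) (a : ι → ℝ) :
    ∑ S ∈ P.powerset, (-1) ^ #S * (∑ i ∈ P, a i - 2 * ∑ i ∈ S, a i) ^ #P =
      2 ^ #P * (#P).factorial * ∏ i ∈ P, a i := by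
  have := sum_powerset_central_difference P a (Polynomial.X ^ #P) (by simp) 0
  simpa using this

theorem abs_dsign {Φ : Finset (E d)} (h : IsRootSet Φ) {w : E d ≃ₗᵢ[ℝ] E d}
    (hw : w ∈ weylGroup Φ) : |dsign w| = 1 := by
  induction hw using Subgroup.closure_induction with
  | mem x hx =>
    obtain ⟨α, hα, hx⟩ := hx
    have : x = rootRefl α := by
      ext1 y
      rw [hx, rootRefl_apply]
    rw [this, dsign_rootRefl (h.ne_zero hα)]
    simp
  | one => simp [dsign_one]
  | mul x y _ _ hx hy => rw [dsign_mul, abs_mul, hx, hy, one_mul]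
  | inv x _ hx =>
    have h1 : dsign x * dsign x⁻¹ = 1 := by rw [← dsign_mul, mul_inv_cancel, dsign_one]
    have h2 : |dsign x| * |dsign x⁻¹| = 1 := by rw [← abs_mul, h1, abs_one]
    rwa [hx, one_mul] at h2

namespace IsSimpleSystem

variable {Φ Δ : Finset (E d)} {v : E d}

/-- The sum of the positive roots pairs with each simple coroot to `2`. -/
theorem inner_sum_posRoots (hΔ : IsSimpleSystem Φ v Δ) {α : E d} (hα : α ∈ Δ) :
    ⟪α, ∑ β ∈ posRoots Φ v, β⟫ = ⟪α, α⟫ := by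
  have hαP := hΔ.subset hα
  have h1 : rootRefl α (∑ β ∈ (posRoots Φ v).erase α, β) = ∑ β ∈ (posRoots Φ v).erase α, β := by
    rw [map_sum]
    have hmem : ∀ β ∈ (posRoots Φ v).erase α, rootRefl α β ∈ (posRoots Φ v).erase α := by
      intro β hβ
      rw [Finset.mem_erase] at hβ ⊢
      refine ⟨fun h0 => ?_, hΔ.refl α hα β hβ.2 hβ.1⟩
      have : β = -α := by rw [← rootRefl_self, ← rootRefl_rootRefl α β, h0]
      have h1 := (mem_posRoots.1 hβ.2).2
      have h2 := (mem_posRoots.1 hαP).2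
      rw [this, inner_neg_left] at h1
      linarith
    exact Finset.sum_nbij' (rootRefl α) (rootRefl α) hmem hmem
      (fun a _ => rootRefl_rootRefl α a) (fun a _ => rootRefl_rootRefl α a) (fun a _ => rfl)
  have h2 : ⟪α, ∑ β ∈ (posRoots Φ v).erase α, β⟫ = 0 := by
    have h3 := (rootRefl α).inner_map_map α (∑ β ∈ (posRoots Φ v).erase α, β)
    rw [h1, rootRefl_self, inner_neg_left] at h3
    linarith
  rw [← Finset.add_sum_erase _ _ hαP, inner_add_right, h2, add_zero]

theorem inner_sum_posRoots_pos (hΔ : IsSimpleSystem Φ v Δ)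
    (h : IsRootSet Φ) {β : E d} (hβ : β ∈ posRoots Φ v) :
    0 < ⟪β, ∑ α ∈ posRoots Φ v, α⟫ := by
  by_contra! hle
  refine h.ne_zero (mem_posRoots.1 hβ).1 (eq_zero_of_mem_span (fun α hα => ?_) (hΔ.span β hβ) hle)
  rw [hΔ.inner_sum_posRoots hα]
  exact real_inner_self_pos.2 (h.ne_zero (hΔ.mem_root hα))

end IsSimpleSystem

/-- The sign pattern on the roots obtained from a positive system by flipping the roots in `S`. -/
def flipSign (Φ : Finset (E d)) (v : E d) (S : Finset (E d)) (α : E d) : ℝ :=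
  if α ∈ posRoots Φ v then (if α ∈ S then -1 else 1) else (if -α ∈ S then 1 else -1)

theorem neg_notMem_posRoots {Φ : Finset (E d)} {v α : E d} (hα : α ∈ posRoots Φ v) :
    -α ∉ posRoots Φ v := by
  intro h1
  have h1 := (mem_posRoots.1 h1).2
  have h2 := (mem_posRoots.1 hα).2
  rw [inner_neg_left] at h1
  linarith

namespace IsRootSet

theorem map_sum_smul {Φ : Finset (E d)} (h : IsRootSet Φ) {w : E d ≃ₗᵢ[ℝ] E d}
    (hw : w ∈ weylGroup Φ) (ε : E d → ℝ) :
    w (∑ α ∈ Φ, ε α • α) = ∑ α ∈ Φ, ε (w⁻¹ α) • α := by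
  rw [map_sum]
  refine Finset.sum_nbij' (fun α => w α) (fun α => w⁻¹ α) (fun α hα => h.weyl_mem hw α hα)
    (fun α hα => h.weyl_mem (inv_mem hw) α hα) (fun α _ => w.symm_apply_apply α)
    (fun α _ => w.apply_symm_apply α) (fun α _ => ?_)
  rw [map_smul, show w⁻¹ (w α) = α from w.symm_apply_apply α]

variable {Φ : Finset (E d)} {v : E d}

theorem flipSign_neg (h : IsRootSet Φ) (hv : ∀ α ∈ Φ, ⟪α, v⟫ ≠ 0)
    (S : Finset (E d)) {α : E d} (hα : α ∈ Φ) :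
    flipSign Φ v S (-α) = -flipSign Φ v S α := by
  rcases h.mem_pos_or_neg hv hα with h1 | h1
  · rw [flipSign, flipSign, if_neg (neg_notMem_posRoots h1), if_pos h1, neg_neg]
    split_ifs <;> simp
  · have h2 := neg_notMem_posRoots h1
    rw [neg_neg] at h2
    rw [flipSign, flipSign, if_neg h2, if_pos h1]
    split_ifs <;> simp

/-- A sum over all roots of an odd sign pattern times the root. -/
theorem sum_odd_smul (h : IsRootSet Φ) (hv : ∀ α ∈ Φ, ⟪α, v⟫ ≠ 0)
    {ε : E d → ℝ} (hε : ∀ α ∈ Φ, ε (-α) = -ε α) :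
    ∑ α ∈ Φ, ε α • α = (2 : ℝ) • ∑ α ∈ posRoots Φ v, ε α • α := by
  have h1 : ∑ α ∈ Φ.filter (fun α => ¬ 0 < ⟪α, v⟫), ε α • α = ∑ α ∈ posRoots Φ v, ε α • α := by
    refine Finset.sum_nbij' (fun α => -α) (fun α => -α) ?_ ?_ (fun a _ => neg_neg a)
      (fun a _ => neg_neg a) ?_
    · intro α hα
      rw [Finset.mem_filter] at hα
      exact (h.mem_pos_or_neg hv hα.1).resolve_left fun h2 => hα.2 (mem_posRoots.1 h2).2
    · intro α hα
      have := mem_posRoots.1 hα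
      rw [Finset.mem_filter]
      refine ⟨h.neg_mem this.1, ?_⟩
      rw [inner_neg_left]
      linarith [this.2]
    · intro α hα
      rw [Finset.mem_filter] at hα
      rw [hε α hα.1, smul_neg, neg_smul, neg_neg]
  rw [← Finset.sum_filter_add_sum_filter_not Φ (fun α => 0 < ⟪α, v⟫), h1, two_smul]
  rfl

theorem sum_flipSign (h : IsRootSet Φ) (hv : ∀ α ∈ Φ, ⟪α, v⟫ ≠ 0)
    {S : Finset (E d)} (hS : S ⊆ posRoots Φ v) :
    ∑ α ∈ Φ, flipSign Φ v S α • α =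
      (2 : ℝ) • (∑ α ∈ posRoots Φ v, α - (2 : ℝ) • ∑ α ∈ S, α) := by
  rw [h.sum_odd_smul hv fun α hα => h.flipSign_neg hv S hα]
  congr 1
  rw [← Finset.sum_sdiff hS, ← Finset.sum_sdiff hS (f := fun α => α)]
  have h1 : ∑ α ∈ posRoots Φ v \ S, flipSign Φ v S α • α = ∑ α ∈ posRoots Φ v \ S, α := by
    refine Finset.sum_congr rfl fun α hα => ?_
    rw [Finset.mem_sdiff] at hα
    rw [flipSign, if_pos hα.1, if_neg hα.2, one_smul]
  have h2 : ∑ α ∈ S, flipSign Φ v S α • α = -∑ α ∈ S, α := by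
    rw [← Finset.sum_neg_distrib]
    refine Finset.sum_congr rfl fun α hα => ?_
    rw [flipSign, if_pos (hS hα), if_pos hα, neg_one_smul]
  rw [h1, h2, two_smul]
  abel

/-- The sign pattern of the inversion set of `w` is the pullback of the standard one. -/
theorem flipSign_inversions (h : IsRootSet Φ) (hv : ∀ α ∈ Φ, ⟪α, v⟫ ≠ 0)
    {w : E d ≃ₗᵢ[ℝ] E d} (hw : w ∈ weylGroup Φ) {α : E d} (hα : α ∈ Φ) :
    flipSign Φ v ((posRoots Φ v).filter fun β => w β ∉ posRoots Φ v) α =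
      flipSign Φ v ∅ (w α) := by
  have hwα := h.weyl_mem hw α hα
  rcases h.mem_pos_or_neg hv hα with h1 | h1
  · rw [flipSign, if_pos h1, flipSign]
    by_cases h2 : w α ∈ posRoots Φ v <;> simp [h1, h2]
  · have h3 := neg_notMem_posRoots h1
    rw [neg_neg] at h3
    rw [flipSign, if_neg h3, flipSign]
    rcases h.mem_pos_or_neg hv hwα with h2 | h2
    · have h4 := neg_notMem_posRoots h2
      simp [h1, h2, h4]
    · have h4 := neg_notMem_posRoots h2
      rw [neg_neg] at h4
      simp [h1, h2, h4]

theorem map_sub_inversions (h : IsRootSet Φ) (hv : ∀ α ∈ Φ, ⟪α, v⟫ ≠ 0)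
    {w : E d ≃ₗᵢ[ℝ] E d} (hw : w ∈ weylGroup Φ) :
    w (∑ α ∈ posRoots Φ v, α - (2 : ℝ) •
      ∑ α ∈ (posRoots Φ v).filter (fun β => w β ∉ posRoots Φ v), α) = ∑ α ∈ posRoots Φ v, α := by
  have h1 := congrArg w (h.sum_flipSign hv
    (S := (posRoots Φ v).filter fun β => w β ∉ posRoots Φ v) (Finset.filter_subset _ _))
  rw [h.map_sum_smul hw, map_smul] at h1
  have h2 := h.sum_flipSign hv (Finset.empty_subset (posRoots Φ v))
  rw [Finset.sum_empty, smul_zero, sub_zero] at h2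
  have h3 : ∑ α ∈ Φ, flipSign Φ v ((posRoots Φ v).filter fun β => w β ∉ posRoots Φ v) (w⁻¹ α) • α
      = ∑ α ∈ Φ, flipSign Φ v ∅ α • α := by
    refine Finset.sum_congr rfl fun α hα => ?_
    rw [h.flipSign_inversions hv hw (h.weyl_mem (inv_mem hw) α hα),
      show w (w⁻¹ α) = α from w.apply_symm_apply α]
  rw [h3, h2] at h1
  exact (smul_right_injective _ (two_ne_zero (α := ℝ)) h1).symm

theorem inversions_injective (h : IsRootSet Φ) (hv : ∀ α ∈ Φ, ⟪α, v⟫ ≠ 0)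
    {w u : E d ≃ₗᵢ[ℝ] E d} (hw : w ∈ weylGroup Φ) (hu : u ∈ weylGroup Φ)
    (heq : (posRoots Φ v).filter (fun β => w β ∉ posRoots Φ v) =
      (posRoots Φ v).filter fun β => u β ∉ posRoots Φ v) : w = u := by
  have h1 : u * w⁻¹ = 1 := by
    refine h.eq_one_of_preserves hv (mul_mem hu (inv_mem hw)) fun β hβ => ?_
    have hβΦ := h.weyl_mem (inv_mem hw) β (mem_posRoots.1 hβ).1
    have h2 := h.flipSign_inversions hv hw hβΦ
    rw [heq, h.flipSign_inversions hv hu hβΦ, show w (w⁻¹ β) = β from w.apply_symm_apply β,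
      flipSign, flipSign, if_pos hβ] at h2
    change u (w⁻¹ β) ∈ _
    by_contra hcon
    rw [if_neg hcon] at h2
    simp only [Finset.notMem_empty, if_false] at h2
    norm_num at h2
  exact (mul_inv_eq_one.1 h1).symm

theorem neg_one_pow_inversions_mul_piP (h : IsRootSet Φ) (hv : ∀ α ∈ Φ, ⟪α, v⟫ ≠ 0)
    {w : E d ≃ₗᵢ[ℝ] E d} (hw : w ∈ weylGroup Φ) :
    (-1) ^ #((posRoots Φ v).filter fun β => w β ∉ posRoots Φ v) *
      piP (posRoots Φ v) (∑ α ∈ posRoots Φ v, α - (2 : ℝ) •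
        ∑ α ∈ (posRoots Φ v).filter (fun β => w β ∉ posRoots Φ v), α) =
      piP (posRoots Φ v) (∑ α ∈ posRoots Φ v, α) := by
  obtain ⟨Δ, hΔ⟩ := h.exists_isSimpleSystem hv
  set P := posRoots Φ v with hP
  set ρ := ∑ α ∈ P, α with hρ
  have hμ : ρ - (2 : ℝ) • ∑ α ∈ P.filter (fun β => w β ∉ P), α = w⁻¹ ρ :=
    (LinearIsometryEquiv.eq_symm_apply w).2 (h.map_sub_inversions hv hw)
  rw [hμ]
  have hin : ∀ β, ⟪β, w⁻¹ ρ⟫ = ⟪w β, ρ⟫ := fun β => by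
    rw [real_inner_comm, inner_inv_left, real_inner_comm]
  have hρpos : 0 < piP P ρ := Finset.prod_pos fun β hβ => hΔ.inner_sum_posRoots_pos h hβ
  have habs : |piP P (w⁻¹ ρ)| = piP P ρ := by
    rw [h.piP_weyl hv (inv_mem hw), abs_mul, abs_dsign h (inv_mem hw), one_mul, abs_of_pos hρpos]
  have hsplit : (-1 : ℝ) ^ #(P.filter fun β => w β ∉ P) =
      ∏ β ∈ P, if w β ∉ P then (-1 : ℝ) else 1 := by
    rw [Finset.prod_ite, Finset.prod_const, Finset.prod_const_one, mul_one]
  rw [← habs, hsplit, piP, ← Finset.prod_mul_distrib, Finset.abs_prod]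
  refine Finset.prod_congr rfl fun β hβ => ?_
  rw [hin]
  by_cases h1 : w β ∈ P
  · rw [if_neg (not_not.2 h1), one_mul, abs_of_pos (hΔ.inner_sum_posRoots_pos h h1)]
  · have h2 := (h.mem_pos_or_neg hv (h.weyl_mem hw β (mem_posRoots.1 hβ).1)).resolve_left h1
    have h3 := hΔ.inner_sum_posRoots_pos h h2
    rw [inner_neg_left] at h3
    rw [if_pos h1, neg_one_mul, abs_of_neg (by linarith)]

/-- In the crystallographic case, a regular vector of the form `∑ α - 2 ∑_{S} α` is conjugate to
the sum of the positive roots, through an element whose inversion set is `S`. -/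
theorem exists_inversions_eq (h : IsRootSet Φ) (hv : ∀ α ∈ Φ, ⟪α, v⟫ ≠ 0)
    (hfin : (weylGroup Φ : Set (E d ≃ₗᵢ[ℝ] E d)).Finite)
    (hcrys : ∀ α ∈ Φ, ∀ β ∈ Φ, ∃ z : ℤ, 2 * ⟪α, β⟫ / ⟪β, β⟫ = (z : ℝ))
    {S : Finset (E d)} (hS : S ⊆ posRoots Φ v)
    (hne : piP (posRoots Φ v) (∑ α ∈ posRoots Φ v, α - (2 : ℝ) • ∑ α ∈ S, α) ≠ 0) :
    ∃ w ∈ weylGroup Φ, (posRoots Φ v).filter (fun β => w β ∉ posRoots Φ v) = S := by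
  obtain ⟨Δ, hΔ⟩ := h.exists_isSimpleSystem hv
  set P := posRoots Φ v with hP
  set ρ := ∑ α ∈ P, α with hρ
  set μ := ρ - (2 : ℝ) • ∑ α ∈ S, α with hμ
  obtain ⟨w, hw, hdom⟩ := h.exists_dominant hfin v μ
  refine ⟨w, hw, ?_⟩
  have hpos : ∀ α ∈ P, 0 < ⟪α, w μ⟫ := by
    have h1 : piP P (w μ) ≠ 0 := by
      rw [h.piP_weyl hv hw]
      refine mul_ne_zero (fun h0 => ?_) hne
      have := abs_dsign h hw
      rw [h0, abs_zero] at this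
      exact zero_ne_one this
    exact fun α hα => lt_of_le_of_ne (hdom α hα) (Finset.prod_ne_zero_iff.1 h1 α hα).symm
  set ε : E d → ℝ := fun α => flipSign Φ v S (w⁻¹ α) with hε
  have hεodd : ∀ α ∈ Φ, ε (-α) = -ε α := fun α hα => by
    rw [hε]
    simp only [map_neg]
    exact h.flipSign_neg hv S (h.weyl_mem (inv_mem hw) α hα)
  have hεval : ∀ α, ε α = 1 ∨ ε α = -1 := fun α => by
    simp only [hε, flipSign]
    split_ifs <;> simp
  set κ := ∑ β ∈ P.filter (fun β => ε β = -1), β with hκ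
  have hwμ : w μ = ρ - (2 : ℝ) • κ := by
    have h1 := congrArg w (h.sum_flipSign hv hS)
    rw [h.map_sum_smul hw, map_smul, h.sum_odd_smul hv hεodd] at h1
    rw [← smul_right_injective _ (two_ne_zero (α := ℝ)) h1, hκ, hρ,
      ← Finset.sum_filter_add_sum_filter_not P (fun β => ε β = -1),
      ← Finset.sum_filter_add_sum_filter_not P (fun β => ε β = -1) (f := fun α => α)]
    have h2 : ∑ α ∈ P.filter (fun β => ε β = -1), ε α • α =
        -∑ α ∈ P.filter (fun β => ε β = -1), α := by
      rw [← Finset.sum_neg_distrib]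
      refine Finset.sum_congr rfl fun α hα => ?_
      rw [(Finset.mem_filter.1 hα).2, neg_one_smul]
    have h3 : ∑ α ∈ P.filter (fun β => ¬ ε β = -1), ε α • α =
        ∑ α ∈ P.filter (fun β => ¬ ε β = -1), α := by
      refine Finset.sum_congr rfl fun α hα => ?_
      rw [(hεval α).resolve_right (Finset.mem_filter.1 hα).2, one_smul]
    rw [h2, h3, two_smul]
    abel
  have hκle : ∀ α ∈ Δ, ⟪α, κ⟫ ≤ 0 := by
    intro α hα
    have hαα : 0 < ⟪α, α⟫ := real_inner_self_pos.2 (h.ne_zero (hΔ.mem_root hα))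
    have hintegral : ∃ z : ℤ, 2 * ⟪α, κ⟫ = z * ⟪α, α⟫ := by
      have h1 : ∀ T : Finset (E d), T ⊆ Φ →
          ∃ z : ℤ, 2 * ⟪α, ∑ β ∈ T, β⟫ = z * ⟪α, α⟫ := by
        intro T
        induction T using Finset.induction_on with
        | empty => exact fun _ => ⟨0, by simp⟩
        | insert β T hβ ih =>
          intro hT
          obtain ⟨z, hz⟩ := ih ((Finset.subset_insert _ _).trans hT)
          obtain ⟨y, hy⟩ := hcrys β (hT (Finset.mem_insert_self _ _)) α (hΔ.mem_root hα)
          rw [div_eq_iff hαα.ne', real_inner_comm] at hy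
          refine ⟨y + z, ?_⟩
          rw [Finset.sum_insert hβ, inner_add_right, mul_add, hz, hy]
          push_cast
          ring
      exact h1 _ ((Finset.filter_subset _ _).trans (Finset.filter_subset _ _))
    obtain ⟨z, hz⟩ := hintegral
    have h1 := hpos α (hΔ.subset hα)
    rw [hwμ, inner_sub_right, real_inner_smul_right, hΔ.inner_sum_posRoots hα, hz] at h1
    have h2 : (z : ℝ) < 1 := by
      by_contra! h3
      nlinarith
    have h3 : z ≤ 0 := by
      have : z < 1 := by exact_mod_cast h2
      omega
    have h4 : (z : ℝ) ≤ 0 := by exact_mod_cast h3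
    nlinarith
  have hκ0 : κ = 0 := by
    by_contra hne
    refine (real_inner_self_pos.2 hne).not_ge ?_
    have h1 : ⟪κ, κ⟫ = ∑ β ∈ P.filter (fun β => ε β = -1), ⟪β, κ⟫ := by
      conv_lhs => rw [hκ, sum_inner]
    rw [h1]
    exact Finset.sum_nonpos fun β hβ => hΔ.inner_nonpos hκle (Finset.mem_filter.1 hβ).1
  have hε1 : ∀ β ∈ P, ε β = 1 := by
    intro β hβ
    refine (hεval β).resolve_right fun hβ1 => ?_
    have h1 : 0 < ⟪κ, v⟫ := by
      rw [hκ, sum_inner]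
      exact Finset.sum_pos (fun β hβ => (mem_posRoots.1 (Finset.mem_filter.1 hβ).1).2)
        ⟨β, Finset.mem_filter.2 ⟨hβ, hβ1⟩⟩
    rw [hκ0, inner_zero_left] at h1
    exact lt_irrefl _ h1
  have hflip : ∀ β, flipSign Φ v S β = ε (w β) := fun β => by
    simp only [hε]
    rw [show w⁻¹ (w β) = β from w.symm_apply_apply β]
  ext β
  rw [Finset.mem_filter]
  constructor
  · rintro ⟨hβ, hwβ⟩
    have h1 := (h.mem_pos_or_neg hv (h.weyl_mem hw β (mem_posRoots.1 hβ).1)).resolve_left hwβ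
    have h2 := hflip β
    have h3 := hεodd (w β) (h.weyl_mem hw β (mem_posRoots.1 hβ).1)
    rw [hε1 _ h1] at h3
    by_contra h4
    rw [flipSign, if_pos hβ, if_neg h4] at h2
    linarith
  · intro hβ
    refine ⟨hS hβ, fun hwβ => ?_⟩
    have h2 := hflip β
    rw [hε1 _ hwβ, flipSign, if_pos (hS hβ), if_pos hβ] at h2
    norm_num at h2

/-- The signed sum of `π` over the exponents of the Weyl denominator. -/
theorem sum_powerset_piP (h : IsRootSet Φ) (hv : ∀ α ∈ Φ, ⟪α, v⟫ ≠ 0)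
    {A : Finset (E d ≃ₗᵢ[ℝ] E d)} (hA : ∀ w, w ∈ A ↔ w ∈ weylGroup Φ)
    (hcrys : ∀ α ∈ Φ, ∀ β ∈ Φ, ∃ z : ℤ, 2 * ⟪α, β⟫ / ⟪β, β⟫ = (z : ℝ)) :
    ∑ S ∈ (posRoots Φ v).powerset, (-1) ^ #S *
      piP (posRoots Φ v) (∑ α ∈ posRoots Φ v, α - (2 : ℝ) • ∑ α ∈ S, α) =
      #A * piP (posRoots Φ v) (∑ α ∈ posRoots Φ v, α) := by
  have hfin : (weylGroup Φ : Set (E d ≃ₗᵢ[ℝ] E d)).Finite :=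
    A.finite_toSet.subset fun w hw => (hA w).2 hw
  rw [← nsmul_eq_mul, ← Finset.sum_const]
  symm
  refine Finset.sum_of_injOn
    (fun w => (posRoots Φ v).filter fun β => w β ∉ posRoots Φ v) ?_ ?_ ?_ ?_
  · exact fun w hw u hu heq => h.inversions_injective hv ((hA w).1 hw) ((hA u).1 hu) heq
  · exact fun w _ => Finset.mem_powerset.2 (Finset.filter_subset _ _)
  · intro S hS hS'
    by_contra hne
    obtain ⟨w, hw, hwS⟩ := h.exists_inversions_eq hv hfin hcrys (Finset.mem_powerset.1 hS)
      (right_ne_zero_of_mul hne)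
    exact hS' ⟨w, (hA w).2 hw, hwS⟩
  · exact fun w hw => (h.neg_one_pow_inversions_mul_piP hv ((hA w).1 hw)).symm

end IsRootSet

theorem sum_eq_zero_of_odd_involution {ι : Type*} {A : Finset ι} {f : ι → ℝ} (e : ι → ι)
    (he : ∀ w ∈ A, e w ∈ A) (hinv : ∀ w ∈ A, e (e w) = w) (hf : ∀ w ∈ A, f (e w) = -f w) :
    ∑ w ∈ A, f w = 0 := by
  have h1 : ∑ w ∈ A, f w = ∑ w ∈ A, -f w :=
    Finset.sum_nbij' e e he he hinv hinv fun w hw => by rw [hf w hw, neg_neg]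
  rw [Finset.sum_neg_distrib] at h1
  linarith

theorem dense_inner_ne_zero (s : Finset (E d)) (hs : ∀ a ∈ s, a ≠ 0) :
    Dense {x : E d | ∀ a ∈ s, ⟪a, x⟫ ≠ 0} := by
  have h1 : {x : E d | ∀ a ∈ s, ⟪a, x⟫ ≠ 0} = ⋂ a ∈ (s : Set (E d)), {x | ⟪a, x⟫ ≠ 0} := by
    ext x
    simp
  rw [h1]
  refine dense_biInter_of_isOpen (fun a _ => ?_) s.countable_toSet fun a ha => ?_
  · exact isOpen_ne_fun (by fun_prop) continuous_const
  · have ha0 : 0 < ‖a‖ := norm_pos_iff.2 (hs a ha)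
    rw [Metric.dense_iff]
    intro x r hr
    by_cases hx : ⟪a, x⟫ = 0
    · refine ⟨x + (r / (2 * ‖a‖)) • a, ?_, ?_⟩
      · rw [Metric.mem_ball, dist_self_add_left, norm_smul, Real.norm_of_nonneg (by positivity)]
        field_simp
        linarith
      · simp only [Set.mem_ofPred_eq]
        rw [inner_add_right, hx, zero_add, real_inner_smul_right, real_inner_self_eq_norm_sq]
        positivity
    · exact ⟨x, Metric.mem_ball_self hr, hx⟩

/-- A vector is generic with respect to `v` if it lies on no root hyperplane and the line through
it in the direction `v` meets the root hyperplanes at pairwise different points. -/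
def IsGeneric (Φ : Finset (E d)) (v x : E d) : Prop :=
  (∀ α ∈ posRoots Φ v, ⟪α, x⟫ ≠ 0) ∧
    Set.InjOn (fun α : E d => -(⟪α, x⟫ / ⟪α, v⟫)) (posRoots Φ v)

theorem IsRootSet.dense_isGeneric {Φ : Finset (E d)} (h : IsRootSet Φ) (v : E d) :
    Dense {x : E d | IsGeneric Φ v x} := by
  set P := posRoots Φ v with hP
  set s : Finset (E d) :=
    P ∪ (P.offDiag.image fun p => ⟪p.2, v⟫ • p.1 - ⟪p.1, v⟫ • p.2) with hs
  refine (dense_inner_ne_zero s ?_).mono ?_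
  · intro a ha
    rw [hs, Finset.mem_union, Finset.mem_image] at ha
    rcases ha with ha | ⟨⟨α, β⟩, hαβ, rfl⟩
    · exact h.ne_zero (mem_posRoots.1 ha).1
    · rw [Finset.mem_offDiag] at hαβ
      intro h0
      have hβ := (mem_posRoots.1 hαβ.2.1).2
      refine hαβ.2.2 (h.eq_of_smul hαβ.2.1 hαβ.1 (⟪α, v⟫ / ⟪β, v⟫) ?_)
      have h2 : ⟪β, v⟫ • α = ⟪α, v⟫ • β := sub_eq_zero.1 h0
      rw [div_eq_inv_mul, mul_smul, ← h2, smul_smul, inv_mul_cancel₀ hβ.ne', one_smul]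
  · intro x hx
    refine ⟨fun α hα => hx α (Finset.mem_union_left _ hα), fun α hα β hβ heq => ?_⟩
    by_contra hne
    refine hx (⟪β, v⟫ • α - ⟪α, v⟫ • β)
      (Finset.mem_union_right _ (Finset.mem_image.2
        ⟨(α, β), Finset.mem_offDiag.2 ⟨hα, hβ, hne⟩, rfl⟩)) ?_
    have hα' := (mem_posRoots.1 hα).2
    have hβ' := (mem_posRoots.1 hβ).2
    have h1 : ⟪α, x⟫ / ⟪α, v⟫ = ⟪β, x⟫ / ⟪β, v⟫ := neg_injective heq
    rw [div_eq_div_iff hα'.ne' hβ'.ne'] at h1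
    rw [inner_sub_left, real_inner_smul_left, real_inner_smul_left]
    linarith

theorem Polynomial.eq_C_mul_nodal {F ι : Type*} [Field F] {s : Finset ι} {z : ι → F}
    (hz : Set.InjOn z s) {Q : Polynomial F} (hdeg : Q.natDegree ≤ #s)
    (hQ : ∀ i ∈ s, Q.eval (z i) = 0) :
    Q = Polynomial.C (Q.coeff #s) * Lagrange.nodal s z := by
  refine Polynomial.eq_of_degree_sub_lt_of_eval_index_eq s hz ?_ fun i hi => ?_
  · rw [Polynomial.degree_lt_iff_coeff_zero]
    intro m hm
    rw [Polynomial.coeff_sub, Polynomial.coeff_C_mul]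
    rcases hm.eq_or_lt with rfl | hm
    · have h1 := (Lagrange.nodal_monic (s := s) (v := z)).coeff_natDegree
      rw [Lagrange.natDegree_nodal] at h1
      rw [h1, mul_one, sub_self]
    · rw [Polynomial.coeff_eq_zero_of_natDegree_lt (hdeg.trans_lt hm),
        Polynomial.coeff_eq_zero_of_natDegree_lt (p := Lagrange.nodal s z)
          (by rwa [Lagrange.natDegree_nodal]), mul_zero, sub_zero]
  · rw [hQ i hi, Polynomial.eval_mul, Lagrange.eval_nodal_at_node hi, mul_zero]

/-- The alternating sum over `A` of the `k`-th powers of `⟪x, w y⟫`. -/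
def altPow (A : Finset (E d ≃ₗᵢ[ℝ] E d)) (k : ℕ) (x y : E d) : ℝ :=
  ∑ w ∈ A, dsign w * ⟪x, w y⟫ ^ k

theorem continuous_altPow (A : Finset (E d ≃ₗᵢ[ℝ] E d)) (k : ℕ) (y : E d) :
    Continuous fun x => altPow A k x y := by
  unfold altPow
  fun_prop

theorem continuous_piP (P : Finset (E d)) : Continuous (piP P) := by
  unfold piP
  fun_prop

theorem piP_self_pos {Φ : Finset (E d)} {v : E d} : 0 < piP (posRoots Φ v) v :=
  Finset.prod_pos fun _ hα => (mem_posRoots.1 hα).2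

theorem IsRootSet.piP_sum_posRoots_pos {Φ : Finset (E d)} (h : IsRootSet Φ) {v : E d}
    (hv : ∀ α ∈ Φ, ⟪α, v⟫ ≠ 0) :
    0 < piP (posRoots Φ v) (∑ α ∈ posRoots Φ v, α) := by
  obtain ⟨Δ, hΔ⟩ := h.exists_isSimpleSystem hv
  exact Finset.prod_pos fun β hβ => hΔ.inner_sum_posRoots_pos h hβ

namespace IsRootSet

variable {Φ : Finset (E d)} {v : E d} {A : Finset (E d ≃ₗᵢ[ℝ] E d)}

theorem altPow_eq_zero_of_inner_eq_zero (h : IsRootSet Φ) (hA : ∀ w, w ∈ A ↔ w ∈ weylGroup Φ)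
    (k : ℕ) {α x : E d} (hα : α ∈ Φ) (hx : ⟪α, x⟫ = 0)
    (y : E d) : altPow A k x y = 0 := by
  refine sum_eq_zero_of_odd_involution (fun w => rootRefl α * w)
    (fun w hw => (hA _).2 (mul_mem (rootRefl_mem_weylGroup hα) ((hA w).1 hw)))
    (fun w _ => by rw [← mul_assoc, rootRefl_mul_self, one_mul]) fun w _ => ?_
  have h1 : ⟪x, (rootRefl α * w) y⟫ = ⟪x, w y⟫ := by
    rw [← (rootRefl α).inner_map_map x (w y), rootRefl_of_inner_eq_zero hx]
    rfl
  rw [dsign_mul, dsign_rootRefl (h.ne_zero hα), h1]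
  ring

theorem altPow_of_isGeneric (h : IsRootSet Φ) (hA : ∀ w, w ∈ A ↔ w ∈ weylGroup Φ)
    {x : E d} (hx : IsGeneric Φ v x) (y : E d) {k : ℕ}
    (hk : k ≤ #(posRoots Φ v)) :
    altPow A k x y * piP (posRoots Φ v) v =
      (if k = #(posRoots Φ v) then altPow A k v y else 0) * piP (posRoots Φ v) x := by
  set P := posRoots Φ v with hP
  set Q : Polynomial ℝ := ∑ w ∈ A, Polynomial.C (dsign w) *
    (Polynomial.C ⟪v, w y⟫ * Polynomial.X + Polynomial.C ⟪x, w y⟫) ^ k with hQ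
  have heval : ∀ t, Q.eval t = altPow A k (x + t • v) y := by
    intro t
    rw [hQ, Polynomial.eval_finsetSum, altPow]
    refine Finset.sum_congr rfl fun w _ => ?_
    simp only [Polynomial.eval_mul, Polynomial.eval_pow, Polynomial.eval_add, Polynomial.eval_C,
      Polynomial.eval_X, inner_add_left, real_inner_smul_left]
    ring
  have hdeg : Q.natDegree ≤ k := by
    refine Polynomial.natDegree_sum_le_of_forall_le _ _ fun w _ => ?_
    refine (Polynomial.natDegree_C_mul_le _ _).trans ((Polynomial.natDegree_pow_le).trans ?_)
    simpa using Nat.mul_le_mul_left k (Polynomial.natDegree_linear_le (a := ⟪v, w y⟫)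
      (b := ⟪x, w y⟫))
  have hcoeff : Q.coeff k = altPow A k v y := by
    rw [hQ, Polynomial.finsetSum_coeff, altPow]
    refine Finset.sum_congr rfl fun w _ => ?_
    rw [Polynomial.coeff_C_mul]
    have h1 := Polynomial.coeff_pow_of_natDegree_le (m := k)
      (Polynomial.natDegree_linear_le (a := ⟪v, w y⟫) (b := ⟪x, w y⟫))
    rw [mul_one] at h1
    rw [h1]
    simp
  have hroot := Polynomial.eq_C_mul_nodal hx.2 (hdeg.trans hk) (fun α hα => by
    have hαv := (mem_posRoots.1 hα).2
    rw [heval]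
    refine h.altPow_eq_zero_of_inner_eq_zero hA k (mem_posRoots.1 hα).1 ?_ y
    rw [inner_add_right, real_inner_smul_right]
    field_simp
    ring)
  have h0 := congrArg (Polynomial.eval 0) hroot
  rw [heval, zero_smul, add_zero, Polynomial.eval_mul, Polynomial.eval_C, Lagrange.eval_nodal]
    at h0
  have h2 : (∏ α ∈ P, (0 - -(⟪α, x⟫ / ⟪α, v⟫))) * piP P v = piP P x := by
    rw [piP, piP, ← Finset.prod_mul_distrib]
    refine Finset.prod_congr rfl fun α hα => ?_
    have hαv := (mem_posRoots.1 hα).2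
    field_simp
    ring
  rw [h0, mul_assoc, h2]
  split_ifs with hkP
  · rw [← hkP, hcoeff]
  · rw [Polynomial.coeff_eq_zero_of_natDegree_lt (hdeg.trans_lt (lt_of_le_of_ne hk hkP))]

theorem altPow_mul_piP (h : IsRootSet Φ) (hA : ∀ w, w ∈ A ↔ w ∈ weylGroup Φ)
    (x y : E d) {k : ℕ} (hk : k ≤ #(posRoots Φ v)) :
    altPow A k x y * piP (posRoots Φ v) v =
      (if k = #(posRoots Φ v) then altPow A k v y else 0) * piP (posRoots Φ v) x := by
  have hcl : IsClosed {x : E d | altPow A k x y * piP (posRoots Φ v) v =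
      (if k = #(posRoots Φ v) then altPow A k v y else 0) * piP (posRoots Φ v) x} :=
    isClosed_eq ((continuous_altPow A k y).mul continuous_const)
      (continuous_const.mul (continuous_piP _))
  have hx : x ∈ closure {x : E d | IsGeneric Φ v x} := h.dense_isGeneric v x
  exact hcl.closure_subset_iff.2 (fun z hz => h.altPow_of_isGeneric hA hz y hk) hx

theorem altPow_eq_zero (h : IsRootSet Φ) (hA : ∀ w, w ∈ A ↔ w ∈ weylGroup Φ)
    (x y : E d) {k : ℕ} (hk : k < #(posRoots Φ v)) : altPow A k x y = 0 := by
  have h1 := h.altPow_mul_piP hA x y hk.le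
  rw [if_neg hk.ne, zero_mul] at h1
  exact (mul_eq_zero.1 h1).resolve_right piP_self_pos.ne'

/-- The lowest nonvanishing alternating power sum of a crystallographic reflection group. -/
theorem altPow_card (h : IsRootSet Φ) (hA : ∀ w, w ∈ A ↔ w ∈ weylGroup Φ) (hv : ∀ α ∈ Φ, ⟪α, v⟫ ≠ 0)
    (hcrys : ∀ α ∈ Φ, ∀ β ∈ Φ, ∃ z : ℤ, 2 * ⟪α, β⟫ / ⟪β, β⟫ = (z : ℝ)) (x y : E d) :
    altPow A #(posRoots Φ v) x y * piP (posRoots Φ v) (∑ α ∈ posRoots Φ v, α) =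
      2 ^ #(posRoots Φ v) * (#(posRoots Φ v)).factorial *
        (piP (posRoots Φ v) x * piP (posRoots Φ v) y) := by
  set P := posRoots Φ v with hP
  set ρ := ∑ α ∈ P, α with hρ
  have hmul : ∀ z, altPow A #P z y * piP P v = altPow A #P v y * piP P z := fun z => by
    have := h.altPow_mul_piP hA z y (le_refl #P)
    rwa [if_pos rfl] at this
  have hv0 : 0 < piP P v := piP_self_pos
  have hsum : ∑ S ∈ P.powerset, (-1) ^ #S * altPow A #P (ρ - (2 : ℝ) • ∑ α ∈ S, α) y =
      #A * (2 ^ #P * (#P).factorial * piP P y) := by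
    have h1 : ∀ w ∈ A, dsign w * ∑ S ∈ P.powerset, (-1) ^ #S *
        ⟪ρ - (2 : ℝ) • ∑ α ∈ S, α, w y⟫ ^ #P = 2 ^ #P * (#P).factorial * piP P y := by
      intro w hw
      have h2 := sum_powerset_sub_pow_card P fun α => ⟪α, w y⟫
      have h3 : ∀ S : Finset (E d), ⟪ρ - (2 : ℝ) • ∑ α ∈ S, α, w y⟫ =
          ∑ α ∈ P, ⟪α, w y⟫ - 2 * ∑ α ∈ S, ⟪α, w y⟫ := fun S => by
        rw [inner_sub_left, real_inner_smul_left, hρ, sum_inner, sum_inner]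
      simp only [h3]
      rw [h2]
      have h4 := h.piP_weyl hv ((hA w).1 hw) y
      rw [← hP] at h4
      rw [show ∏ α ∈ P, ⟪α, w y⟫ = piP P (w y) from rfl, h4]
      have h5 : dsign w * dsign w = 1 := by
        rw [← abs_mul_abs_self, abs_dsign h ((hA w).1 hw), one_mul]
      linear_combination (2 ^ #P * (#P).factorial * piP P y) * h5
    rw [← nsmul_eq_mul, ← Finset.sum_const, ← Finset.sum_congr rfl h1]
    simp only [altPow, Finset.mul_sum]
    rw [Finset.sum_comm]
    exact Finset.sum_congr rfl fun w _ => Finset.sum_congr rfl fun S _ => by ring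
  have hρv : altPow A #P v y * (#A * piP P ρ) =
      #A * (2 ^ #P * (#P).factorial * piP P y) * piP P v := by
    rw [← hsum, ← h.sum_powerset_piP hv hA hcrys, Finset.mul_sum, Finset.sum_mul]
    refine Finset.sum_congr rfl fun S _ => ?_
    linear_combination -(-1) ^ #S * hmul (ρ - (2 : ℝ) • ∑ α ∈ S, α)
  have hA0 : (#A : ℝ) ≠ 0 := by
    have : A.Nonempty := ⟨1, (hA 1).2 (one_mem _)⟩
    exact_mod_cast this.card_pos.ne'
  have hρv' : altPow A #P v y * piP P ρ = 2 ^ #P * (#P).factorial * piP P y * piP P v :=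
    mul_left_cancel₀ hA0 (by linear_combination hρv)
  refine mul_right_cancel₀ hv0.ne' ?_
  linear_combination piP P ρ * hmul x + piP P x * hρv'

end IsRootSet

/-- Iterated Rolle theorem for a sequence of successive derivatives. -/
theorem exists_iterated_deriv_eq_zero {a b : ℝ} (n : ℕ) {f : ℕ → ℝ → ℝ}
    (hf : ∀ k < n, ∀ x ∈ Set.Ioo a b, HasDerivAt (f k) (f (k + 1) x) x)
    {z : Fin (n + 1) → ℝ} (hz : StrictMono z) (hzI : ∀ i, z i ∈ Set.Ioo a b)
    (hz0 : ∀ i, f 0 (z i) = 0) : ∃ x ∈ Set.Ioo a b, f n x = 0 := by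
  induction n generalizing f with
  | zero => exact ⟨z 0, hzI 0, hz0 0⟩
  | succ n ih =>
    have hstep : ∀ i : Fin (n + 1), ∃ y ∈ Set.Ioo (z i.castSucc) (z i.succ), f 1 y = 0 := by
      intro i
      have hsub : ∀ y ∈ Set.Icc (z i.castSucc) (z i.succ), y ∈ Set.Ioo a b := fun y hy =>
        ⟨(hzI _).1.trans_le hy.1, hy.2.trans_lt (hzI _).2⟩
      refine exists_hasDerivAt_eq_zero (f := f 0) (hz i.castSucc_lt_succ) (fun y hy => ?_)
        (by rw [hz0, hz0])
        fun y hy => hf 0 n.succ_pos y (hsub y (Set.Ioo_subset_Icc_self hy))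
      exact (hf 0 n.succ_pos y (hsub y hy)).continuousAt.continuousWithinAt
    choose y hy hy0 using hstep
    refine ih (f := fun k => f (k + 1)) (z := y) (fun k hk x hx => hf (k + 1) (by omega) x hx)
      (fun i j hij => ?_) (fun i => ⟨(hzI _).1.trans (hy i).1, (hy i).2.trans (hzI _).2⟩) hy0
    exact (hy i).2.trans_le ((hz.monotone (Fin.succ_le_castSucc_iff.2 hij)).trans (hy j).1.le)

/-- A function with `n` zeros near `0` is small at `0`. -/
theorem abs_le_mul_prod_abs_zeros {a b M : ℝ} {f : ℕ → ℝ → ℝ} {Z : Finset ℝ}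
    (hf : ∀ k < #Z, ∀ x ∈ Set.Ioo a b, HasDerivAt (f k) (f (k + 1) x) x)
    (hM : ∀ x ∈ Set.Ioo a b, |f #Z x| ≤ M) (h0 : (0 : ℝ) ∈ Set.Ioo a b)
    (hZ : ∀ z ∈ Z, z ∈ Set.Ioo a b ∧ f 0 z = 0) :
    |f 0 0| ≤ M * ∏ z ∈ Z, |z| := by
  have hM0 : 0 ≤ M := (abs_nonneg _).trans (hM 0 h0)
  by_cases h0Z : (0 : ℝ) ∈ Z
  · rw [(hZ 0 h0Z).2, abs_zero]
    exact mul_nonneg hM0 (Finset.prod_nonneg fun _ _ => abs_nonneg _)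
  set q : Polynomial ℝ := ∏ z ∈ Z, (Polynomial.X - Polynomial.C z) with hq
  have hq0 : |q.eval 0| = ∏ z ∈ Z, |z| := by
    rw [hq, Polynomial.eval_prod, Finset.abs_prod]
    exact Finset.prod_congr rfl fun z _ => by simp
  have hqne : q.eval 0 ≠ 0 := by
    rw [← abs_pos, hq0]
    exact Finset.prod_pos fun z hz => abs_pos.2 fun h => h0Z (h ▸ hz)
  set c : ℝ := f 0 0 / q.eval 0 with hc
  have hcard : #(insert 0 Z) = #Z + 1 := Finset.card_insert_of_notMem h0Z
  obtain ⟨x, hx, hx0⟩ := exists_iterated_deriv_eq_zero (a := a) (b := b) #Z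
    (f := fun k x => f k x - c * (Polynomial.derivative^[k] q).eval x)
    (z := (insert 0 Z).orderEmbOfFin hcard)
    (fun k hk x hx => by
      rw [Function.iterate_succ_apply']
      exact (hf k hk x hx).sub ((Polynomial.hasDerivAt _ x).const_mul c))
    (OrderEmbedding.strictMono _)
    (fun i => by
      rcases Finset.mem_insert.1 (Finset.orderEmbOfFin_mem _ hcard i) with h | h
      · rw [h]; exact h0
      · exact (hZ _ h).1)
    (fun i => by
      rcases Finset.mem_insert.1 (Finset.orderEmbOfFin_mem _ hcard i) with h | h
      · rw [h, Function.iterate_zero_apply, hc, div_mul_cancel₀ _ hqne, sub_self]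
      · rw [(hZ _ h).2, Function.iterate_zero_apply, hq, Polynomial.eval_prod,
          Finset.prod_eq_zero h (by simp)]
        simp)
  have hder : (Polynomial.derivative^[#Z] q).eval x = (#Z).factorial := by
    rw [hq, Polynomial.iterate_derivative_prod_X_sub_C le_rfl]
    simp
  rw [hder] at hx0
  have hcM : |c| ≤ M := by
    have h1 : |c| * (#Z).factorial ≤ M := by
      rw [← abs_of_nonneg (Nat.cast_nonneg (α := ℝ) (#Z).factorial), ← abs_mul,
        ← sub_eq_zero.1 hx0]
      exact hM x hx
    have h2 : (1 : ℝ) ≤ (#Z).factorial := by exact_mod_cast (#Z).factorial_pos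
    nlinarith [abs_nonneg c]
  rw [← hq0, ← div_mul_cancel₀ (f 0 0) hqne, abs_mul]
  exact mul_le_mul_of_nonneg_right hcM (abs_nonneg _)

/-- A smooth function with `n` zeros on a short segment through `q` in a fixed direction is
controlled at `q` by the product of the distances to the zeros, uniformly in `q`. -/
theorem exists_abs_le_mul_prod_zeros {V : Type*} [NormedAddCommGroup V] [NormedSpace ℝ V]
    {F : V → ℝ} {U : Set V} (hU : IsOpen U) {p : V} (hp : p ∈ U) (hF : ContDiffOn ℝ ⊤ F U)
    (u : V) (n : ℕ) :
    ∃ C, ∃ δ > 0, ∀ q, dist q p < δ → ∀ Z : Finset ℝ, #Z = n →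
      (∀ z ∈ Z, |z| < δ ∧ F (q + z • u) = 0) → |F q| ≤ C * ∏ z ∈ Z, |z| := by
  set G : ℕ → V → ℝ := fun k => (fun (g : V → ℝ) q => fderiv ℝ g q u)^[k] F with hG
  have hG1 : ∀ k q, G (k + 1) q = fderiv ℝ (G k) q u := fun k q => by
    simp only [hG, Function.iterate_succ_apply']
  have hGs : ∀ k, ContDiffOn ℝ ⊤ (G k) U := by
    intro k
    induction k with
    | zero => exact hF
    | succ k ih =>
      have h1 : G (k + 1) = fun q => fderiv ℝ (G k) q u := funext (hG1 k)
      rw [h1]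
      exact (ih.fderiv_of_isOpen hU (by simp)).clm_apply contDiffOn_const
  have hcont : ContinuousAt (G n) p := (hGs n).continuousOn.continuousAt (hU.mem_nhds hp)
  have hnear : ∀ᶠ q in nhds p, |G n q| < |G n p| + 1 :=
    hcont.abs.eventually (gt_mem_nhds (by linarith))
  obtain ⟨r, hr, hball⟩ := Metric.eventually_nhds_iff.1 (hnear.and (hU.mem_nhds hp))
  have hu : 0 < ‖u‖ + 1 := by positivity
  refine ⟨|G n p| + 1, min (r / 2) (r / 2 / (‖u‖ + 1)), by positivity, fun q hq Z hZn hZ => ?_⟩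
  set δ := r / 2 / (‖u‖ + 1) with hδ
  have hin : ∀ x ∈ Set.Ioo (-δ) δ, dist (q + x • u) p < r := by
    intro x hx
    have h1 : |x| < δ := abs_lt.2 hx
    have h2 : ‖x • u‖ ≤ r / 2 := by
      rw [norm_smul, Real.norm_eq_abs]
      rw [hδ, lt_div_iff₀ hu] at h1
      nlinarith [abs_nonneg x, norm_nonneg u]
    calc dist (q + x • u) p ≤ dist (q + x • u) q + dist q p := dist_triangle _ _ _
      _ < r / 2 + r / 2 := by
        rw [dist_self_add_left]
        exact add_lt_add_of_le_of_lt h2 (hq.trans_le (min_le_left _ _))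
      _ = r := by ring
  have h := abs_le_mul_prod_abs_zeros (a := -δ) (b := δ) (M := |G n p| + 1) (Z := Z)
    (f := fun k x => G k (q + x • u))
    (fun k _ x hx => by
      have hd : DifferentiableAt ℝ (G k) (q + x • u) :=
        ((hGs k).contDiffAt (hU.mem_nhds (hball (hin x hx)).2)).differentiableAt (by simp)
      have hl : HasDerivAt (fun x : ℝ => q + x • u) u x := by
        simpa using ((hasDerivAt_id x).smul_const u).const_add q
      rw [hG1]
      exact hd.hasFDerivAt.comp_hasDerivAt x hl)
    (fun x hx => by rw [hZn]; exact (hball (hin x hx)).1.le)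
    (by
      have : 0 < δ := by positivity
      exact ⟨by linarith, this⟩)
    (fun z hz => ⟨abs_lt.1 ((hZ z hz).1.trans_le (min_le_right _ _)), (hZ z hz).2⟩)
  simp only [zero_smul, add_zero] at h
  exact h

theorem Ring.choose_add_sub_one_mul_factorial (a : ℝ) (n : ℕ) :
    Ring.choose (a + n - 1) n * n.factorial = ∏ k ∈ Finset.range n, (a + k) := by
  have h1 : Ring.choose (a + n - 1) n = Ring.multichoose a n := by
    rw [Ring.choose]
    congr 1
    ring
  have h2 := Ring.factorial_nsmul_multichoose_eq_ascPochhammer a n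
  rw [h1, mul_comm, ← nsmul_eq_mul, h2, Polynomial.ascPochhammer_smeval_eq_eval]
  clear h1 h2
  induction n with
  | zero => simp
  | succ n ih => rw [ascPochhammer_succ_eval, ih, Finset.prod_range_succ]

/-- Leading asymptotics of a combination of binomial functions whose low moments vanish. -/
theorem tendsto_sum_one_sub_rpow {ι : Type*} (A : Finset ι) (ε b : ι → ℝ) (a : ℝ) (n : ℕ)
    (hmom : ∀ k < n, ∑ i ∈ A, ε i * b i ^ k = 0) :
    Filter.Tendsto (fun s : ℝ => (∑ i ∈ A, ε i * (1 - s * b i) ^ (-a)) / s ^ n)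
      (nhdsWithin 0 {0}ᶜ)
      (nhds ((∏ k ∈ Finset.range n, (a + k)) / n.factorial * ∑ i ∈ A, ε i * b i ^ n)) := by
  set c : ℕ → ℝ := fun k => Ring.choose (a + k - 1) k with hc
  set R : ℝ → ℝ := fun y => (1 - y) ^ (-a) - ∑ k ∈ Finset.range (n + 1), c k * y ^ k with hR
  have hRO : R =O[nhds 0] fun y => ‖y‖ ^ (n + 1) := by
    have h1 := (Real.one_div_one_sub_rpow_hasFPowerSeriesOnBall_zero a).hasFPowerSeriesAt
      |>.isBigO_sub_partialSum_pow (n + 1)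
    refine h1.congr' ?_ Filter.EventuallyEq.rfl
    have hlt : ∀ᶠ y : ℝ in nhds 0, y < 1 := gt_mem_nhds one_pos
    filter_upwards [hlt] with y hy
    rw [hR, zero_add, FormalMultilinearSeries.partialSum]
    simp only
    rw [Real.rpow_neg (by linarith), one_div]
    congr 1
    refine Finset.sum_congr rfl fun k _ => ?_
    rw [FormalMultilinearSeries.ofScalars_apply_eq, smul_eq_mul]
  have hterm : ∀ i ∈ A, Filter.Tendsto (fun s : ℝ => ε i * (R (s * b i) / s ^ n))
      (nhdsWithin 0 {0}ᶜ) (nhds 0) := by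
    intro i _
    have hlim : Filter.Tendsto (fun s : ℝ => s * b i) (nhds 0) (nhds 0) := by
      simpa using (continuous_mul_const (b i)).tendsto (0 : ℝ)
    have h1 : (fun s : ℝ => R (s * b i)) =o[nhds 0] fun s => s ^ n := by
      refine (hRO.comp_tendsto hlim).trans_isLittleO ?_
      have h2 : (fun s : ℝ => ‖s * b i‖ ^ (n + 1)) =O[nhds 0] fun s : ℝ => s ^ (n + 1) := by
        refine Asymptotics.IsBigO.of_bound (|b i| ^ (n + 1)) (Filter.Eventually.of_forall fun s => ?_)
        simp only [norm_pow, norm_mul, Real.norm_eq_abs, abs_abs]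
        rw [mul_pow, mul_comm]
      exact h2.trans_isLittleO (Asymptotics.isLittleO_pow_pow n.lt_succ_self)
    have h3 := (h1.mono (nhdsWithin_le_nhds (s := {0}ᶜ))).tendsto_div_nhds_zero
    simpa using h3.const_mul (ε i)
  have hsum := tendsto_finsetSum A hterm
  rw [Finset.sum_const_zero] at hsum
  have hlim := hsum.add_const (c n * ∑ i ∈ A, ε i * b i ^ n)
  rw [zero_add] at hlim
  have hcn : c n = (∏ k ∈ Finset.range n, (a + k)) / n.factorial := by
    rw [← Ring.choose_add_sub_one_mul_factorial, mul_div_cancel_right₀]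
    exact_mod_cast n.factorial_ne_zero
  rw [hcn] at hlim
  refine hlim.congr' ?_
  filter_upwards [self_mem_nhdsWithin] with s hs
  have hs0 : s ^ n ≠ 0 := pow_ne_zero _ hs
  have hmain : ∑ i ∈ A, ε i * ∑ k ∈ Finset.range (n + 1), c k * (s * b i) ^ k =
      c n * s ^ n * ∑ i ∈ A, ε i * b i ^ n := by
    have h1 : ∑ i ∈ A, ε i * ∑ k ∈ Finset.range (n + 1), c k * (s * b i) ^ k =
        ∑ k ∈ Finset.range (n + 1), c k * s ^ k * ∑ i ∈ A, ε i * b i ^ k := by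
      simp only [Finset.mul_sum]
      rw [Finset.sum_comm]
      exact Finset.sum_congr rfl fun k _ => Finset.sum_congr rfl fun i _ => by ring
    rw [h1, Finset.sum_range_succ, Finset.sum_eq_zero, zero_add]
    intro k hk
    rw [hmom k (Finset.mem_range.1 hk), mul_zero]
  rw [← hcn, eq_div_iff hs0, add_mul, Finset.sum_mul]
  have h2 : ∀ i ∈ A, ε i * (R (s * b i) / s ^ n) * s ^ n = ε i * (1 - s * b i) ^ (-a) -
      ε i * ∑ k ∈ Finset.range (n + 1), c k * (s * b i) ^ k := by
    intro i _
    rw [mul_assoc, div_mul_cancel₀ _ hs0, hR]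
    ring
  rw [Finset.sum_congr rfl h2, Finset.sum_sub_distrib, hmain]
  ring

/-- The alternating sum over `B` of the kernels `‖X - w Y‖^{-d}`. -/
def altKernel (B : Finset (E d ≃ₗᵢ[ℝ] E d)) (X Y : E d) : ℝ :=
  ∑ w ∈ B, dsign w * ‖X - w Y‖ ^ (-(d : ℝ))

theorem altKernel_eq_zero_left {B : Finset (E d ≃ₗᵢ[ℝ] E d)} {α X : E d} (hα : α ≠ 0)
    (hB : ∀ w ∈ B, rootRefl α * w ∈ B) (hX : ⟪α, X⟫ = 0) (Y : E d) : altKernel B X Y = 0 := by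
  refine sum_eq_zero_of_odd_involution (fun w => rootRefl α * w) hB
    (fun w _ => by rw [← mul_assoc, rootRefl_mul_self, one_mul]) fun w _ => ?_
  have h1 : ‖X - (rootRefl α * w) Y‖ = ‖X - w Y‖ := by
    rw [← (rootRefl α).norm_map (X - w Y), map_sub, rootRefl_of_inner_eq_zero hX]
    rfl
  rw [dsign_mul, dsign_rootRefl hα, h1]
  ring

theorem altKernel_eq_zero_right {B : Finset (E d ≃ₗᵢ[ℝ] E d)} {α Y : E d} (hα : α ≠ 0)
    (hB : ∀ w ∈ B, w * rootRefl α ∈ B) (hY : ⟪α, Y⟫ = 0) (X : E d) : altKernel B X Y = 0 := by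
  refine sum_eq_zero_of_odd_involution (fun w => w * rootRefl α) hB
    (fun w _ => by rw [mul_assoc, rootRefl_mul_self, mul_one]) fun w _ => ?_
  have h1 : (w * rootRefl α) Y = w Y := congrArg w (rootRefl_of_inner_eq_zero hY)
  rw [dsign_mul, dsign_rootRefl hα, h1]
  ring

theorem isOpen_forall_ne_map (B : Finset (E d ≃ₗᵢ[ℝ] E d)) :
    IsOpen {p : E d × E d | ∀ w ∈ B, p.1 ≠ w p.2} := by
  have h1 : {p : E d × E d | ∀ w ∈ B, p.1 ≠ w p.2} =
      ⋂ w ∈ B, {p : E d × E d | p.1 ≠ w p.2} := by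
    ext p
    simp
  rw [h1]
  exact isOpen_biInter_finset fun w _ =>
    isOpen_ne_fun continuous_fst (w.continuous.comp continuous_snd)

theorem contDiffOn_altKernel (B : Finset (E d ≃ₗᵢ[ℝ] E d)) :
    ContDiffOn ℝ ⊤ (fun p : E d × E d => altKernel B p.1 p.2)
      {p : E d × E d | ∀ w ∈ B, p.1 ≠ w p.2} := by
  intro p hp
  refine ContDiffAt.contDiffWithinAt ?_
  unfold altKernel
  refine ContDiffAt.sum fun w hw => contDiffAt_const.mul ?_
  have hne : p.1 - w p.2 ≠ 0 := sub_ne_zero.2 (hp w hw)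
  have h1 : ContDiffAt ℝ ⊤ (fun p : E d × E d => p.1 - w p.2) p :=
    contDiffAt_fst.sub (w.contDiff.contDiffAt.comp p contDiffAt_snd)
  exact (h1.norm ℝ hne).rpow_const_of_ne (norm_ne_zero_iff.2 hne)

theorem IsGeneric.mono {Φ Ψ : Finset (E d)} {v x : E d} (h : IsGeneric Φ v x) (hΨ : Ψ ⊆ Φ) :
    IsGeneric Ψ v x := by
  have hsub : posRoots Ψ v ⊆ posRoots Φ v := Finset.filter_subset_filter _ hΨ
  exact ⟨fun α hα => h.1 α (hsub hα), h.2.mono hsub⟩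

/-- Away from the stabilizer of `Y₀`, the alternating kernel vanishes to the order of the product
of the positive roots in each variable. -/
theorem IsRootSet.exists_altKernel_le {Ψ : Finset (E d)} (h : IsRootSet Ψ) (v : E d)
    {B : Finset (E d ≃ₗᵢ[ℝ] E d)} (hl : ∀ α ∈ Ψ, ∀ w ∈ B, rootRefl α * w ∈ B)
    (hr : ∀ α ∈ Ψ, ∀ w ∈ B, w * rootRefl α ∈ B) {Y₀ : E d} (hY₀ : ∀ α ∈ Ψ, ⟪α, Y₀⟫ = 0)
    (hB : ∀ w ∈ B, w Y₀ ≠ Y₀) {η : E d} (hη : IsGeneric Ψ v η) :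
    ∃ C, ∀ᶠ X in nhds Y₀, IsGeneric Ψ v X → ∀ᶠ t : ℝ in nhdsWithin 0 (Set.Ioi 0),
      |altKernel B X (Y₀ + t • η)| ≤ C * |piP (posRoots Ψ v) X| * t ^ #(posRoots Ψ v) := by
  set P := posRoots Ψ v with hP
  have hPv : ∀ α ∈ P, 0 < ⟪α, v⟫ := fun α hα => (mem_posRoots.1 hα).2
  have hPΨ : ∀ α ∈ P, α ∈ Ψ := fun α hα => (mem_posRoots.1 hα).1
  obtain ⟨C, δ, hδ, hC⟩ := exists_abs_le_mul_prod_zeros (isOpen_forall_ne_map B) (p := (Y₀, Y₀))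
    (fun w hw => (hB w hw).symm) (contDiffOn_altKernel B) (v, v) (#P + #P)
  refine ⟨C * (|piP P η| / |piP P v| ^ 2), ?_⟩
  have hXnear : ∀ᶠ X in nhds Y₀, dist X Y₀ < δ ∧ ∀ α ∈ P, |-(⟪α, X⟫ / ⟪α, v⟫)| < δ := by
    refine Filter.Eventually.and (Metric.ball_mem_nhds Y₀ hδ) ?_
    rw [Filter.eventually_all_finset]
    intro α hα
    have hc : ContinuousAt (fun X : E d => |-(⟪α, X⟫ / ⟪α, v⟫)|) Y₀ := by fun_prop
    refine hc.eventually (gt_mem_nhds ?_)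
    simp only [hY₀ α (hPΨ α hα), zero_div, neg_zero, abs_zero]
    exact hδ
  filter_upwards [hXnear] with X hX hXgen
  have hsmall : ∀ᶠ t : ℝ in nhdsWithin 0 (Set.Ioi 0), dist (Y₀ + t • η) Y₀ < δ ∧
      ∀ α ∈ P, |t * -(⟪α, η⟫ / ⟪α, v⟫)| < δ ∧
        ∀ β ∈ P, |t * -(⟪α, η⟫ / ⟪α, v⟫)| < |-(⟪β, X⟫ / ⟪β, v⟫)| := by
    refine Filter.Eventually.filter_mono nhdsWithin_le_nhds (Filter.Eventually.and ?_ ?_)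
    · have hc : ContinuousAt (fun t : ℝ => dist (Y₀ + t • η) Y₀) 0 := by fun_prop
      refine hc.eventually (gt_mem_nhds ?_)
      simpa using hδ
    · rw [Filter.eventually_all_finset]
      intro α hα
      have hc : ContinuousAt (fun t : ℝ => |t * -(⟪α, η⟫ / ⟪α, v⟫)|) 0 := by fun_prop
      refine (hc.eventually (gt_mem_nhds (by simpa using hδ))).and ?_
      rw [Filter.eventually_all_finset]
      intro β hβ
      refine hc.eventually (gt_mem_nhds ?_)
      simp only [zero_mul, abs_zero]
      rw [abs_pos]
      exact neg_ne_zero.2 (div_ne_zero (hXgen.1 β hβ) (hPv β hβ).ne')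
  filter_upwards [hsmall, self_mem_nhdsWithin] with t ht ht0
  rw [Set.mem_Ioi] at ht0
  set z₁ : E d → ℝ := fun α => -(⟪α, X⟫ / ⟪α, v⟫) with hz₁
  set z₂ : E d → ℝ := fun α => t * -(⟪α, η⟫ / ⟪α, v⟫) with hz₂
  have hinj₁ : Set.InjOn z₁ P := hXgen.2
  have hinj₂ : Set.InjOn z₂ P := fun α hα β hβ hab =>
    hη.2 hα hβ (mul_left_cancel₀ ht0.ne' hab)
  have hdisj : Disjoint (P.image z₁) (P.image z₂) := by
    rw [Finset.disjoint_left]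
    intro x hx₁ hx₂
    obtain ⟨β, hβ, rfl⟩ := Finset.mem_image.1 hx₁
    obtain ⟨α, hα, hαβ⟩ := Finset.mem_image.1 hx₂
    have h1 := (ht.2 α hα).2 β hβ
    rw [show t * -(⟪α, η⟫ / ⟪α, v⟫) = -(⟪β, X⟫ / ⟪β, v⟫) from hαβ] at h1
    exact lt_irrefl _ h1
  have hbound := hC (X, Y₀ + t • η) (max_lt hX.1 ht.1) (P.image z₁ ∪ P.image z₂)
    (by rw [Finset.card_union_of_disjoint hdisj, Finset.card_image_of_injOn hinj₁,
      Finset.card_image_of_injOn hinj₂])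
    (by
      intro x hx
      rcases Finset.mem_union.1 hx with hx | hx
      · obtain ⟨α, hα, rfl⟩ := Finset.mem_image.1 hx
        refine ⟨hX.2 α hα, altKernel_eq_zero_left (h.ne_zero (hPΨ α hα)) (hl α (hPΨ α hα)) ?_ _⟩
        have := (hPv α hα).ne'
        simp only [hz₁, Prod.smul_mk, Prod.mk_add_mk]
        rw [inner_add_right, real_inner_smul_right]
        field_simp
        ring
      · obtain ⟨α, hα, rfl⟩ := Finset.mem_image.1 hx
        refine ⟨(ht.2 α hα).1,
          altKernel_eq_zero_right (h.ne_zero (hPΨ α hα)) (hr α (hPΨ α hα)) ?_ _⟩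
        have := (hPv α hα).ne'
        simp only [hz₂, Prod.smul_mk, Prod.mk_add_mk]
        rw [inner_add_right, inner_add_right, hY₀ α (hPΨ α hα), real_inner_smul_right,
          real_inner_smul_right]
        field_simp
        ring)
  refine hbound.trans_eq ?_
  rw [Finset.prod_union hdisj, Finset.prod_image hinj₁, Finset.prod_image hinj₂]
  have h1 : ∏ α ∈ P, |z₁ α| = |piP P X| / |piP P v| := by
    rw [piP, piP, Finset.abs_prod, Finset.abs_prod, ← Finset.prod_div_distrib]
    exact Finset.prod_congr rfl fun α _ => by rw [hz₁, abs_neg, abs_div]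
  have h2 : ∏ α ∈ P, |z₂ α| = t ^ #P * (|piP P η| / |piP P v|) := by
    rw [piP, piP, Finset.abs_prod, Finset.abs_prod, ← Finset.prod_div_distrib,
      ← Finset.prod_const, ← Finset.prod_mul_distrib]
    exact Finset.prod_congr rfl fun α _ => by rw [hz₂, abs_mul, abs_neg, abs_div, abs_of_pos ht0]
  rw [h1, h2]
  ring

/-- The leading behaviour of the alternating kernel of the stabilizer of `Y₀` as the second
argument approaches `Y₀` along a ray. -/
theorem IsRootSet.tendsto_altKernel_div_pow {Ψ : Finset (E d)} (h : IsRootSet Ψ) {v : E d}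
    (hv : ∀ α ∈ Ψ, ⟪α, v⟫ ≠ 0) {A : Finset (E d ≃ₗᵢ[ℝ] E d)}
    (hA : ∀ w, w ∈ A ↔ w ∈ weylGroup Ψ)
    (hcrys : ∀ α ∈ Ψ, ∀ β ∈ Ψ, ∃ z : ℤ, 2 * ⟪α, β⟫ / ⟪β, β⟫ = (z : ℝ))
    {Y₀ : E d} (hY₀ : ∀ w ∈ A, w Y₀ = Y₀) {X : E d} (hX : X ≠ Y₀) (η : E d) :
    Filter.Tendsto (fun t : ℝ => altKernel A X (Y₀ + t • η) / t ^ #(posRoots Ψ v))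
      (nhdsWithin 0 (Set.Ioi 0))
      (nhds (2 ^ (2 * #(posRoots Ψ v)) *
        (∏ k ∈ Finset.range #(posRoots Ψ v), ((d : ℝ) / 2 + (k : ℝ))) /
        piP (posRoots Ψ v) (∑ α ∈ posRoots Ψ v, α) *
        (piP (posRoots Ψ v) X * piP (posRoots Ψ v) η) /
        ‖X - Y₀‖ ^ (2 * #(posRoots Ψ v) + d))) := by
  set P := posRoots Ψ v with hP
  set c : ℝ → ℝ := fun t => ‖X‖ ^ 2 - 2 * ⟪X, Y₀⟫ + ‖Y₀ + t • η‖ ^ 2 with hc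
  have hc0 : c 0 = ‖X - Y₀‖ ^ 2 := by
    simp only [hc]
    rw [zero_smul, add_zero, norm_sub_sq_real]
  have hXY : 0 < ‖X - Y₀‖ := norm_pos_iff.2 (sub_ne_zero.2 hX)
  have hc0pos : 0 < c 0 := hc0 ▸ by positivity
  have hccont : Continuous c := by
    simp only [hc]
    fun_prop
  have hclim : Filter.Tendsto c (nhdsWithin 0 (Set.Ioi 0)) (nhds (c 0)) :=
    hccont.continuousAt.tendsto.mono_left nhdsWithin_le_nhds
  have hcpos : ∀ᶠ t in nhdsWithin 0 (Set.Ioi 0), 0 < c t := hclim.eventually (lt_mem_nhds hc0pos)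
  have hid : Filter.Tendsto (fun t : ℝ => t) (nhdsWithin 0 (Set.Ioi 0)) (nhds 0) :=
    Filter.tendsto_id.mono_left nhdsWithin_le_nhds
  have hs : Filter.Tendsto (fun t => 2 * t / c t) (nhdsWithin 0 (Set.Ioi 0))
      (nhdsWithin 0 {0}ᶜ) := by
    refine tendsto_nhdsWithin_iff.2 ⟨?_, ?_⟩
    · have h1 := (hid.const_mul 2).div hclim hc0pos.ne'
      rw [mul_zero, zero_div] at h1
      exact h1
    · filter_upwards [hcpos, self_mem_nhdsWithin] with t ht ht0
      rw [Set.mem_Ioi] at ht0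
      have : 2 * t / c t ≠ 0 := by positivity
      exact this
  have hbin := (tendsto_sum_one_sub_rpow A dsign (fun w => ⟪X, w η⟫) ((d : ℝ) / 2) #P
    fun k hk => h.altPow_eq_zero hA X η hk).comp hs
  have hlim := (((hclim.rpow_const (p := -((d : ℝ) / 2)) (Or.inl hc0pos.ne')).mul
    (((tendsto_const_nhds (x := (2 : ℝ))).div hclim hc0pos.ne').pow #P)).mul hbin)
  have hval : c 0 ^ (-((d : ℝ) / 2)) * (2 / c 0) ^ #P *
      ((∏ k ∈ Finset.range #P, ((d : ℝ) / 2 + k)) / (#P).factorial *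
        ∑ w ∈ A, dsign w * ⟪X, w η⟫ ^ #P) =
      2 ^ (2 * #P) * (∏ k ∈ Finset.range #P, ((d : ℝ) / 2 + (k : ℝ))) /
        piP P (∑ α ∈ P, α) * (piP P X * piP P η) / ‖X - Y₀‖ ^ (2 * #P + d) := by
    have h1 := h.altPow_card hA hv hcrys X η
    rw [← hP, altPow] at h1
    have hρ : 0 < piP P (∑ α ∈ P, α) := h.piP_sum_posRoots_pos hv
    rw [← eq_div_iff hρ.ne'] at h1
    have h2 : c 0 ^ (-((d : ℝ) / 2)) = (‖X - Y₀‖ ^ d)⁻¹ := by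
      rw [hc0, Real.rpow_neg (by positivity), ← Real.rpow_natCast _ 2, ← Real.rpow_mul hXY.le,
        ← Real.rpow_natCast]
      congr 2
      push_cast
      ring
    have hfac : ((#P).factorial : ℝ) ≠ 0 := by exact_mod_cast (#P).factorial_ne_zero
    rw [h1, h2, hc0, div_pow, ← pow_mul, pow_add, pow_mul 2 2]
    have hn := hXY.ne'
    have h4 : (2 ^ 2 : ℝ) ^ #P = 2 ^ #P * 2 ^ #P := by rw [← mul_pow]; norm_num
    rw [h4]
    field_simp
  rw [← hval]
  refine hlim.congr' ?_
  filter_upwards [hcpos, self_mem_nhdsWithin] with t ht ht0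
  rw [Set.mem_Ioi] at ht0
  have hterm : ∀ w ∈ A, dsign w * ‖X - w (Y₀ + t • η)‖ ^ (-(d : ℝ)) =
      c t ^ (-((d : ℝ) / 2)) * (dsign w * (1 - 2 * t / c t * ⟪X, w η⟫) ^ (-((d : ℝ) / 2))) := by
    intro w hw
    have h1 : ‖X - w (Y₀ + t • η)‖ ^ 2 = c t * (1 - 2 * t / c t * ⟪X, w η⟫) := by
      rw [norm_sub_sq_real, w.norm_map, map_add, map_smul, hY₀ w hw, inner_add_right,
        real_inner_smul_right, mul_sub, mul_one, ← mul_assoc, mul_div_cancel₀ _ ht.ne']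
      simp only [hc]
      ring
    have h2 : 0 ≤ 1 - 2 * t / c t * ⟪X, w η⟫ := by
      have : 0 ≤ c t * (1 - 2 * t / c t * ⟪X, w η⟫) := h1 ▸ sq_nonneg _
      exact nonneg_of_mul_nonneg_right this ht
    have h3 : ‖X - w (Y₀ + t • η)‖ ^ (-(d : ℝ)) =
        (‖X - w (Y₀ + t • η)‖ ^ 2) ^ (-((d : ℝ) / 2)) := by
      rw [← Real.rpow_natCast _ 2, ← Real.rpow_mul (norm_nonneg _)]
      congr 1
      push_cast
      ring
    rw [h3, h1, Real.mul_rpow ht.le h2]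
    ring
  rw [altKernel, Finset.sum_congr rfl hterm, ← Finset.mul_sum, Function.comp_apply]
  have ht1 : t ≠ 0 := ht0.ne'
  have ht2 : c t ≠ 0 := ht.ne'
  generalize ∑ w ∈ A, dsign w * (1 - 2 * t / c t * ⟪X, w η⟫) ^ (-((d : ℝ) / 2)) = σ
  simp only [Pi.div_apply]
  rw [div_pow, div_pow, mul_pow]
  field_simp

/-- Comparison of the leading coefficient of the alternating kernel at `Y₀`, along a generic ray,
with the contribution of the stabilizer of `Y₀`. -/
theorem IsRootSet.exists_abs_sub_le {Φ : Finset (E d)} (h : IsRootSet Φ) {v : E d}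
    (hv : ∀ α ∈ Φ, ⟪α, v⟫ ≠ 0)
    (hcrys : ∀ α ∈ Φ, ∀ β ∈ Φ, ∃ z : ℤ, 2 * ⟪α, β⟫ / ⟪β, β⟫ = (z : ℝ))
    {A : Finset (E d ≃ₗᵢ[ℝ] E d)} (hA : ∀ w, w ∈ A ↔ w ∈ weylGroup Φ) (Y₀ : E d)
    {P : Finset (E d)} (hP : P = posRoots (Φ.filter fun α => ⟪α, Y₀⟫ = 0) v)
    {η : E d} (hη : IsGeneric Φ v η) :
    ∃ C, ∀ᶠ X in nhds Y₀, X ≠ Y₀ → IsGeneric Φ v X → ∀ L : ℝ,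
      Filter.Tendsto (fun t : ℝ => altKernel A X (Y₀ + t • η) / t ^ #P)
        (nhdsWithin 0 (Set.Ioi 0)) (nhds L) →
      |L - 2 ^ (2 * #P) * (∏ k ∈ Finset.range #P, ((d : ℝ) / 2 + (k : ℝ))) /
        piP P (∑ α ∈ P, α) * (piP P X * piP P η) / ‖X - Y₀‖ ^ (2 * #P + d)| ≤
          C * |piP P X| := by
  set Ψ := Φ.filter fun α => ⟪α, Y₀⟫ = 0 with hΨ
  have hsub : Ψ ⊆ Φ := Finset.filter_subset _ _
  have hΨY : ∀ α ∈ Ψ, ⟪α, Y₀⟫ = 0 := fun α hα => (Finset.mem_filter.1 hα).2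
  have hfix : ∀ α ∈ Ψ, rootRefl α Y₀ = Y₀ := fun α hα => rootRefl_of_inner_eq_zero (hΨY α hα)
  have hrefl : ∀ α ∈ Ψ, rootRefl α ∈ weylGroup Φ := fun α hα =>
    rootRefl_mem_weylGroup (hsub hα)
  have hfin : (weylGroup Φ : Set (E d ≃ₗᵢ[ℝ] E d)).Finite :=
    A.finite_toSet.subset fun w hw => (hA w).2 hw
  have hΨroot : IsRootSet Ψ := h.filter_orthogonal Y₀
  set B := A.filter fun w => ¬ w Y₀ = Y₀ with hB
  have hstab : ∀ w, w ∈ A.filter (fun w => w Y₀ = Y₀) ↔ w ∈ weylGroup Ψ := by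
    intro w
    rw [Finset.mem_filter, hA]
    exact ⟨fun hw => h.mem_weylGroup_filter hfin hv hw.1 hw.2,
      fun hw => ⟨weylGroup_mono hsub hw, weylGroup_filter_fixes hw⟩⟩
  have hl : ∀ α ∈ Ψ, ∀ w ∈ B, rootRefl α * w ∈ B := by
    intro α hα w hw
    rw [hB, Finset.mem_filter, hA] at hw ⊢
    refine ⟨mul_mem (hrefl α hα) hw.1, fun h1 => hw.2 ?_⟩
    have h2 : rootRefl α (w Y₀) = Y₀ := h1
    rw [← rootRefl_rootRefl α (w Y₀), h2, hfix α hα]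
  have hr : ∀ α ∈ Ψ, ∀ w ∈ B, w * rootRefl α ∈ B := by
    intro α hα w hw
    rw [hB, Finset.mem_filter, hA] at hw ⊢
    refine ⟨mul_mem hw.1 (hrefl α hα), fun h1 => hw.2 ?_⟩
    have h2 : w (rootRefl α Y₀) = Y₀ := h1
    rwa [hfix α hα] at h2
  obtain ⟨C, hC⟩ := hΨroot.exists_altKernel_le v hl hr hΨY
    (fun w hw => (Finset.mem_filter.1 hw).2) (hη.mono hsub)
  rw [← hP] at hC
  refine ⟨C, ?_⟩
  filter_upwards [hC] with X hX hne hgen L hL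
  have hlim := hΨroot.tendsto_altKernel_div_pow (fun α hα => hv α (hsub hα)) hstab
    (fun α hα β hβ => hcrys α (hsub hα) β (hsub hβ))
    (fun w hw => (Finset.mem_filter.1 hw).2) hne η
  rw [← hP] at hlim
  refine le_of_tendsto (hL.sub hlim).abs ?_
  filter_upwards [hX (hgen.mono hsub), self_mem_nhdsWithin] with t ht ht0
  rw [Set.mem_Ioi] at ht0
  have hsplit : altKernel A X (Y₀ + t • η) =
      altKernel (A.filter fun w => w Y₀ = Y₀) X (Y₀ + t • η) + altKernel B X (Y₀ + t • η) :=
    (Finset.sum_filter_add_sum_filter_not A _ _).symm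
  rw [hsplit, add_div, add_sub_cancel_left, abs_div, abs_of_pos (pow_pos ht0 _),
    div_le_iff₀ (pow_pos ht0 _)]
  exact ht

theorem piP_add_smul {P : Finset (E d)} {Y : E d} (hP : ∀ α ∈ P, ⟪α, Y⟫ = 0) (t : ℝ) (η : E d) :
    piP P (Y + t • η) = t ^ #P * piP P η := by
  rw [piP, piP, ← Finset.prod_const, ← Finset.prod_mul_distrib]
  refine Finset.prod_congr rfl fun α hα => ?_
  rw [inner_add_right, hP α hα, real_inner_smul_right, zero_add]

theorem mem_Dset_of_norm_lt {Φ : Finset (E d)} {X Y : E d} (h : ‖X‖ < ‖Y‖) :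
    (X, Y) ∈ Dset Φ := by
  intro w hw
  have h1 : ‖X‖ = ‖w.1 Y‖ := congrArg norm hw
  rw [w.1.norm_map] at h1
  exact h.ne h1

theorem continuousAt_of_norm_lt {Φ : Finset (E d)} {T : E d × E d → ℝ}
    (hT : ContinuousOn T (Dset Φ)) {X Y : E d} (h : ‖X‖ < ‖Y‖) : ContinuousAt T (X, Y) := by
  refine hT.continuousAt (Filter.mem_of_superset ?_ fun p (hp : ‖p.1‖ < ‖p.2‖) =>
    mem_Dset_of_norm_lt hp)
  exact (isOpen_lt continuous_fst.norm continuous_snd.norm).mem_nhds h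

/-- Boundary asymptotics of the continuous extension of the alternating kernel divided by
`π(X) π(Y)`. -/
theorem IsRootSet.tendsto_pow_mul {Φ : Finset (E d)} (h : IsRootSet Φ) {v : E d}
    (hv : ∀ α ∈ Φ, ⟪α, v⟫ ≠ 0)
    (hcrys : ∀ α ∈ Φ, ∀ β ∈ Φ, ∃ z : ℤ, 2 * ⟪α, β⟫ / ⟪β, β⟫ = (z : ℝ))
    {A : Finset (E d ≃ₗᵢ[ℝ] E d)} (hA : ∀ w, w ∈ A ↔ w ∈ weylGroup Φ) (hd : 1 ≤ d)
    {Y₀ : E d} (hY₀ : ‖Y₀‖ = 1) {T : E d × E d → ℝ} (hTcont : ContinuousOn T (Dset Φ))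
    {R P : Finset (E d)} (hR : R = posRoots Φ v) (hP : P = R.filter fun α => ⟪α, Y₀⟫ = 0)
    (hT : ∀ X Y : E d, (X, Y) ∈ Dset Φ → piP R X * piP R Y ≠ 0 →
      T (X, Y) = (piP R X * piP R Y)⁻¹ * altKernel A X Y) :
    Filter.Tendsto (fun X : E d => ‖X - Y₀‖ ^ (2 * #P + d) * T (X, Y₀))
      (nhdsWithin Y₀ (Metric.ball (0 : E d) 1))
      (nhds (2 ^ (2 * #P) * (∏ k ∈ Finset.range #P, ((d : ℝ) / 2 + (k : ℝ))) /
        (piP P (∑ α ∈ P, α) * (piP (R \ P) Y₀) ^ 2))) := by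
  have hPΨ : P = posRoots (Φ.filter fun α => ⟪α, Y₀⟫ = 0) v := by
    rw [hP, hR, posRoots, posRoots, Finset.filter_comm]
  have hPR : P ⊆ R := hP ▸ Finset.filter_subset _ _
  have hPY : ∀ α ∈ P, ⟪α, Y₀⟫ = 0 := fun α hα => by
    rw [hP, Finset.mem_filter] at hα
    exact hα.2
  have hsplit : ∀ X, piP R X = piP (R \ P) X * piP P X := fun X =>
    (Finset.prod_sdiff hPR).symm
  have hQ0 : piP (R \ P) Y₀ ≠ 0 := by
    refine Finset.prod_ne_zero_iff.2 fun α hα h0 => ?_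
    rw [Finset.mem_sdiff] at hα
    exact hα.2 (hP ▸ Finset.mem_filter.2 ⟨hα.1, h0⟩)
  have hgenR : ∀ {X}, IsGeneric Φ v X → piP R X ≠ 0 := fun hX =>
    Finset.prod_ne_zero_iff.2 fun α hα => hX.1 α (hR ▸ hα)
  obtain ⟨η, hη⟩ := (h.dense_isGeneric v).nonempty
  have hηP : piP P η ≠ 0 := right_ne_zero_of_mul (hsplit η ▸ hgenR hη)
  obtain ⟨C, hC⟩ := h.exists_abs_sub_le hv hcrys hA Y₀ hPΨ hη
  set K : ℝ := 2 ^ (2 * #P) * (∏ k ∈ Finset.range #P, ((d : ℝ) / 2 + (k : ℝ))) /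
    piP P (∑ α ∈ P, α) with hK
  have hlim : ∀ X : E d, ‖X‖ < 1 → IsGeneric Φ v X →
      Filter.Tendsto (fun t : ℝ => altKernel A X (Y₀ + t • η) / t ^ #P)
        (nhdsWithin 0 (Set.Ioi 0))
        (nhds (T (X, Y₀) * (piP R X * (piP (R \ P) Y₀ * piP P η)))) := by
    intro X hX hXgen
    have hYc : ContinuousAt (fun t : ℝ => Y₀ + t • η) 0 := by fun_prop
    have hY0 : Y₀ + (0 : ℝ) • η = Y₀ := by rw [zero_smul, add_zero]
    have hXY : ‖X‖ < ‖Y₀‖ := hY₀ ▸ hX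
    have hTc : ContinuousAt (fun t : ℝ => T (X, Y₀ + t • η)) 0 := by
      have h1 : ContinuousAt T (X, Y₀ + (0 : ℝ) • η) := by
        rw [hY0]
        exact continuousAt_of_norm_lt hTcont hXY
      exact h1.comp (f := fun t : ℝ => (X, Y₀ + t • η)) (continuousAt_const.prodMk hYc)
    have hQc : ContinuousAt (fun t : ℝ => piP (R \ P) (Y₀ + t • η)) 0 :=
      (continuous_piP _).continuousAt.comp hYc
    have hall := hTc.mul (continuousAt_const (y := piP R X) |>.mul
      (hQc.mul (continuousAt_const (y := piP P η))))
    have hall' := hall.tendsto.mono_left (nhdsWithin_le_nhds (s := Set.Ioi (0 : ℝ)))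
    simp only [Pi.mul_apply, hY0] at hall'
    refine hall'.congr' ?_
    have hQne : ∀ᶠ t : ℝ in nhds 0, piP (R \ P) (Y₀ + t • η) ≠ 0 :=
      hQc.eventually_ne (by simpa only [hY0] using hQ0)
    have hnorm : ∀ᶠ t : ℝ in nhds 0, ‖X‖ < ‖Y₀ + t • η‖ :=
      hYc.norm.eventually (lt_mem_nhds (by simpa only [hY0] using hXY))
    filter_upwards [hQne.filter_mono nhdsWithin_le_nhds, hnorm.filter_mono nhdsWithin_le_nhds,
      self_mem_nhdsWithin] with t ht1 ht2 ht0
    rw [Set.mem_Ioi] at ht0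
    have hRX := hgenR hXgen
    have ht3 : t ^ #P ≠ 0 := (pow_pos ht0 _).ne'
    have hRY : piP R (Y₀ + t • η) = piP (R \ P) (Y₀ + t • η) * (t ^ #P * piP P η) := by
      rw [hsplit, piP_add_smul hPY]
    have hRY0 : piP R (Y₀ + t • η) ≠ 0 := hRY ▸ mul_ne_zero ht1 (mul_ne_zero ht3 hηP)
    simp only [Pi.mul_apply]
    rw [hT X _ (mem_Dset_of_norm_lt ht2) (mul_ne_zero hRX hRY0), hRY]
    field_simp
  have hmain : ∀ᶠ X in nhdsWithin Y₀ (Metric.ball (0 : E d) 1),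
      |‖X - Y₀‖ ^ (2 * #P + d) * T (X, Y₀) * (piP (R \ P) X * piP (R \ P) Y₀) - K| ≤
        C / |piP P η| * ‖X - Y₀‖ ^ (2 * #P + d) := by
    obtain ⟨U, hUC, hUo, hUY⟩ := eventually_nhds_iff.1 hC
    filter_upwards [inter_mem_nhdsWithin (Metric.ball (0 : E d) 1) (hUo.mem_nhds hUY)] with X hX
    have hopen : IsOpen (Metric.ball (0 : E d) 1 ∩ U) := Metric.isOpen_ball.inter hUo
    have hcont : ∀ Z ∈ Metric.ball (0 : E d) 1 ∩ U, ContinuousAt (fun Z : E d =>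
        |‖Z - Y₀‖ ^ (2 * #P + d) * T (Z, Y₀) * (piP (R \ P) Z * piP (R \ P) Y₀) - K| -
          C / |piP P η| * ‖Z - Y₀‖ ^ (2 * #P + d)) Z := by
      intro Z hZ
      have h1 : ContinuousAt (fun Z : E d => T (Z, Y₀)) Z :=
        (continuousAt_of_norm_lt hTcont (by rw [hY₀]; exact mem_ball_zero_iff.1 hZ.1)).comp
          (f := fun Z : E d => (Z, Y₀)) (continuousAt_id.prodMk continuousAt_const)
      have h2 : ContinuousAt (piP (R \ P)) Z := (continuous_piP _).continuousAt
      have h3 : ContinuousAt (fun Z : E d => ‖Z - Y₀‖ ^ (2 * #P + d)) Z := by fun_prop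
      exact (((h3.mul h1).mul (h2.mul continuousAt_const)).sub continuousAt_const).abs.sub
        (continuousAt_const.mul h3)
    by_contra! hlt
    have hmem := (hcont X hX).eventually (lt_mem_nhds (sub_pos.2 hlt))
    obtain ⟨Z, ⟨hZU, hZpos⟩, hZgen⟩ := mem_closure_iff_nhds.1 (h.dense_isGeneric v X) _
      (Filter.inter_mem (hopen.mem_nhds hX) hmem)
    have hZ1 : ‖Z‖ < 1 := mem_ball_zero_iff.1 hZU.1
    have hZne : Z ≠ Y₀ := fun h1 => by rw [h1, hY₀] at hZ1; exact lt_irrefl _ hZ1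
    have hZ := hUC Z hZU.2 hZne hZgen _ (hlim Z hZ1 hZgen)
    have hZP : piP P Z ≠ 0 := right_ne_zero_of_mul (hsplit Z ▸ hgenR hZgen)
    have hr : 0 < ‖Z - Y₀‖ ^ (2 * #P + d) := pow_pos (norm_pos_iff.2 (sub_ne_zero.2 hZne)) _
    rw [Set.mem_ofPred_eq, sub_pos] at hZpos
    refine not_le.2 hZpos ?_
    generalize ‖Z - Y₀‖ ^ (2 * #P + d) = r at hZ hr ⊢
    have h1 : T (Z, Y₀) * (piP R Z * (piP (R \ P) Y₀ * piP P η)) - K * (piP P Z * piP P η) / r =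
        (r * T (Z, Y₀) * (piP (R \ P) Z * piP (R \ P) Y₀) - K) * (piP P Z * piP P η) / r := by
      rw [hsplit]
      field_simp
    have h2 : 0 < |piP P Z| := abs_pos.2 hZP
    have h3 : 0 < |piP P η| := abs_pos.2 hηP
    rw [h1, abs_div, abs_mul, abs_mul, abs_of_pos hr, div_le_iff₀ hr] at hZ
    rw [div_mul_eq_mul_div, le_div_iff₀ h3]
    refine le_of_mul_le_mul_right ?_ h2
    linarith
  have hzero : Filter.Tendsto (fun X : E d => C / |piP P η| * ‖X - Y₀‖ ^ (2 * #P + d))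
      (nhdsWithin Y₀ (Metric.ball (0 : E d) 1)) (nhds 0) := by
    have h1 : Continuous fun X : E d => C / |piP P η| * ‖X - Y₀‖ ^ (2 * #P + d) := by fun_prop
    have h2 := (h1.tendsto Y₀).mono_left
      (nhdsWithin_le_nhds (s := Metric.ball (0 : E d) 1))
    rwa [sub_self, norm_zero, zero_pow (by omega), mul_zero] at h2
  have hprod : Filter.Tendsto (fun X : E d =>
      ‖X - Y₀‖ ^ (2 * #P + d) * T (X, Y₀) * (piP (R \ P) X * piP (R \ P) Y₀))
      (nhdsWithin Y₀ (Metric.ball (0 : E d) 1)) (nhds K) := by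
    rw [tendsto_iff_norm_sub_tendsto_zero]
    exact squeeze_zero' (Filter.Eventually.of_forall fun X => norm_nonneg _) hmain hzero
  have hQlim : Filter.Tendsto (fun X : E d => piP (R \ P) X * piP (R \ P) Y₀)
      (nhdsWithin Y₀ (Metric.ball (0 : E d) 1)) (nhds (piP (R \ P) Y₀ * piP (R \ P) Y₀)) :=
    (((continuous_piP _).tendsto Y₀).mono_left nhdsWithin_le_nhds).mul_const _
  have hquot := hprod.div hQlim (mul_ne_zero hQ0 hQ0)
  rw [hK, div_div, ← sq] at hquot
  refine hquot.congr' ?_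
  filter_upwards [hQlim.eventually_ne (mul_ne_zero hQ0 hQ0)] with X hX
  exact mul_div_cancel_right₀ _ hX

end

/-- asymptotics of the Poisson kernel at a boundary point. Let `T` be the
unique continuous function on `D` with
`T(X,Y) = (π(X)π(Y))⁻¹ ∑_{w∈W} det(w) |X - wY|^{-d}` whenever `π(X)π(Y) ≠ 0`.
For `Y₀` on the unit sphere, with `Σ'₊ = {α ∈ Σ⁺ : ⟪α,Y₀⟫ = 0}`, `γ' = |Σ'₊|`,
`ρ' = ∑_{α∈Σ'₊} α`, `π' = ∏_{α∈Σ'₊}⟪α,·⟫`, `π'' = ∏_{α∈Σ⁺∖Σ'₊}⟪α,·⟫`, one has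
`|X - Y₀|^{2γ'+d} T(X,Y₀) → 2^{2γ'} (d/2)_{γ'} / (π'(ρ') π''(Y₀)²)` as `X → Y₀`, `|X| < 1`. -/
theorem stmt_7 (d : ℕ) (hd : 1 ≤ d) (Sig Sp : Finset (E d))
    (hroot : IsRootSystem Sig) (hpos : IsPositiveSystem Sig Sp)
    (hcrys : ∀ α ∈ Sig, ∀ β ∈ Sig, ∃ z : ℤ, 2 * ⟪α, β⟫ / ⟪β, β⟫ = (z : ℝ))
    [Fintype ↥(weylGroup Sig)]
    (Y₀ : E d) (hY₀ : ‖Y₀‖ = 1)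
    (Sp' : Finset (E d)) (hSp' : Sp' = Sp.filter (fun α => ⟪α, Y₀⟫ = 0))
    (T : E d × E d → ℝ)
    (hTcont : ContinuousOn T (Dset Sig))
    (hTeq : ∀ X Y : E d, (X, Y) ∈ Dset Sig → piP Sp X * piP Sp Y ≠ 0 →
      T (X, Y) = (piP Sp X * piP Sp Y)⁻¹ *
        ∑ w : ↥(weylGroup Sig), dsign w.1 * ‖X - w.1 Y‖ ^ (-(d : ℝ))) :
    Filter.Tendsto (fun X : E d => ‖X - Y₀‖ ^ (2 * Sp'.card + d) * T (X, Y₀))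
      (nhdsWithin Y₀ (Metric.ball (0 : E d) 1))
      (nhds (2 ^ (2 * Sp'.card) * (∏ k ∈ Finset.range Sp'.card, ((d : ℝ) / 2 + (k : ℝ))) /
        (piP Sp' (∑ α ∈ Sp', α) * (piP (Sp \ Sp') Y₀) ^ 2))) := by
  obtain ⟨hzero, -, hred, hrefl⟩ := hroot
  obtain ⟨v, hv, hSp⟩ := hpos
  have h : IsRootSet Sig := ⟨hzero, hred, hrefl⟩
  have hR : Sp = posRoots Sig v := Finset.ext fun α => (hSp α).trans mem_posRoots.symm
  set A : Finset (E d ≃ₗᵢ[ℝ] E d) :=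
    Finset.univ.map (Function.Embedding.subtype fun w => w ∈ weylGroup Sig) with hA
  have hmem : ∀ w, w ∈ A ↔ w ∈ weylGroup Sig := fun w => by simp [hA]
  refine h.tendsto_pow_mul hv hcrys hmem hd hY₀ hTcont hR hSp' fun X Y hXY hne => ?_
  rw [hTeq X Y hXY hne, altKernel, hA, Finset.sum_map]
  rfl
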